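/- arXiv:1401.2174 — 3 statements merged into one kernel-verified Lean document; each statement's English description precedes it below -/
import Mathlib

section
/- Let 𝔤 be a complex simple Lie algebra with a grading of Monge type determined by a nonempty subset Σ of the simple roots, and suppose dim 𝔤₋₁ = 2. Then the pair (𝔤, Σ) is one of exactly the following five: A₂ with Σ = {α₁, α₂}; B₂ with Σ = {α₂} (the short simple root); B₂ with Σ = {α₁, α₂}; G₂ with Σ = {α₁} (the short simple root); G₂ with Σ = {α₁, α₂}. Conversely, each of these five gradings is of Monge type with dim 𝔤₋₁ = 2. -/
open scoped RealInnerProductSpace BigOperators Classical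

/-- A reduced crystallographic root system in a real inner product space,
together with a chosen base of simple roots and the coordinates of each
root with respect to the base. -/
structure RootSystemBase (V : Type*) [NormedAddCommGroup V] [InnerProductSpace ℝ V] where
  /-- the set of roots -/
  Δ : Finset V
  /-- the set of simple roots (the base) -/
  Δ0 : Finset V
  base_sub : Δ0 ⊆ Δ
  ne_zero : ∀ β ∈ Δ, β ≠ (0 : V)
  indep : LinearIndependent ℝ (fun a : ↥Δ0 => (a : V))
  neg_mem : ∀ β ∈ Δ, -β ∈ Δ
  /-- `coeff β α` is the coefficient `n_α` of the simple root `α` in `β = ∑ n_α • α` -/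
  coeff : V → V → ℤ
  coeff_spec : ∀ β ∈ Δ, β = ∑ α ∈ Δ0, (coeff β α : ℝ) • α
  coeff_sign : ∀ β ∈ Δ, (∀ α ∈ Δ0, 0 ≤ coeff β α) ∨ (∀ α ∈ Δ0, coeff β α ≤ 0)
  crystal : ∀ α ∈ Δ, ∀ β ∈ Δ, ∃ k : ℤ, 2 * ⟪β, α⟫ / ⟪α, α⟫ = (k : ℝ)
  reflect_mem : ∀ α ∈ Δ, ∀ β ∈ Δ, β - (2 * ⟪β, α⟫ / ⟪α, α⟫) • α ∈ Δ
  reduced : ∀ α ∈ Δ, (2 : ℝ) • α ∉ Δ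

namespace RootSystemBase

variable {V : Type*} [NormedAddCommGroup V] [InnerProductSpace ℝ V]

variable (R : RootSystemBase V)

/-- The height `ht_Σ(β)` of a root `β` relative to a subset `Sg` of the simple roots. -/
def ht (Sg : Finset V) (β : V) : ℤ := ∑ α ∈ Sg, R.coeff β α

/-- positive roots -/
def IsPos (β : V) : Prop := β ∈ R.Δ ∧ ∀ α ∈ R.Δ0, 0 ≤ R.coeff β α

/-- negative roots -/
def IsNeg (β : V) : Prop := β ∈ R.Δ ∧ ∀ α ∈ R.Δ0, R.coeff β α ≤ 0

/-- Irreducibility of the root system (the Dynkin diagram is connected); this is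
equivalent to the corresponding complex Lie algebra being simple. -/
def Irred : Prop :=
  ¬ ∃ S : Finset V, S ⊆ R.Δ0 ∧ S.Nonempty ∧ S ≠ R.Δ0 ∧
      ∀ a ∈ S, ∀ b ∈ R.Δ0, b ∉ S → ⟪a, b⟫ = 0

/-- Adjacency of two (simple) roots in the Dynkin diagram. -/
def Adj (a b : V) : Prop := a ≠ b ∧ ⟪a, b⟫ ≠ 0

end RootSystemBase

namespace RootSystemBase

variable {V : Type*} [NormedAddCommGroup V] [InnerProductSpace ℝ V]

/-- The Cartan pairing `⟨a, b⟩ = 2(a,b)/(b,b)`. -/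
noncomputable def cInt (a b : V) : ℝ := 2 * ⟪a, b⟫ / ⟪b, b⟫

end RootSystemBase

/-- The root space decomposition data of a complex semisimple Lie algebra `L` with
root system `base`: a Cartan subalgebra `H`, one-dimensional root spaces `rs β`,
and the standard bracket relations among them. -/
structure GradedLieData (V : Type*) [NormedAddCommGroup V] [InnerProductSpace ℝ V]
    (L : Type*) [LieRing L] [LieAlgebra ℂ L] where
  /-- the underlying root system with base -/
  base : RootSystemBase V
  /-- the Cartan subalgebra -/
  H : Submodule ℂ L
  /-- the root spaces -/
  rs : V → Submodule ℂ L
  rs_dim : ∀ β ∈ base.Δ, Module.finrank ℂ ↥(rs β) = 1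
  rs_bot : ∀ v : V, v ∉ base.Δ → rs v = ⊥
  sup_eq_top : H ⊔ (⨆ β ∈ base.Δ, rs β) = ⊤
  h_indep : Disjoint H (⨆ β ∈ base.Δ, rs β)
  rs_indep : ∀ β ∈ base.Δ, Disjoint (rs β) (H ⊔ ⨆ γ ∈ base.Δ.erase β, rs γ)
  /-- `toH v` is the element of the Cartan subalgebra representing `v` via the Killing
  form -/
  toH : V → L
  toH_mem : ∀ v : V, toH v ∈ H
  toH_add : ∀ u v : V, toH (u + v) = toH u + toH v
  H_span : H = Submodule.span ℂ (toH '' ↑base.Δ0)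
  br_toH : ∀ v : V, ∀ β ∈ base.Δ, ∀ x ∈ rs β, ⁅toH v, x⁆ = ((⟪β, v⟫ : ℝ) : ℂ) • x
  br_h_h : ∀ h ∈ H, ∀ h' ∈ H, ⁅h, h'⁆ = (0 : L)
  br_h_rs : ∀ β ∈ base.Δ, ∀ h ∈ H, ∀ x ∈ rs β, ⁅h, x⁆ ∈ rs β
  br_rs_mem : ∀ β ∈ base.Δ, ∀ γ ∈ base.Δ, β + γ ∈ base.Δ →
      ∀ x ∈ rs β, ∀ y ∈ rs γ, ⁅x, y⁆ ∈ rs (β + γ)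
  br_rs_zero : ∀ β ∈ base.Δ, ∀ γ ∈ base.Δ, β + γ ∉ base.Δ → β + γ ≠ 0 →
      ∀ x ∈ rs β, ∀ y ∈ rs γ, ⁅x, y⁆ = (0 : L)
  br_rs_opp : ∀ β ∈ base.Δ, ∀ x ∈ rs β, ∀ y ∈ rs (-β),
      ⁅x, y⁆ ∈ Submodule.span ℂ ({toH β} : Set L)
  br_nondeg : ∀ β ∈ base.Δ, ∀ γ ∈ base.Δ, β + γ ∈ base.Δ →
      ∀ x ∈ rs β, ∀ y ∈ rs γ, ⁅x, y⁆ = (0 : L) → x = 0 ∨ y = 0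

namespace GradedLieData

variable {V : Type*} [NormedAddCommGroup V] [InnerProductSpace ℝ V]
variable {L : Type*} [LieRing L] [LieAlgebra ℂ L]

variable (G : GradedLieData V L)

/-- The grading component `𝔤ⱼ` of the grading of `L` determined by the subset `Sg`
of the simple roots. -/
def g (Sg : Finset V) (j : ℤ) : Submodule ℂ L :=
  if j = 0 then G.H ⊔ ⨆ β ∈ G.base.Δ.filter (fun β => G.base.ht Sg β = 0), G.rs β
  else ⨆ β ∈ G.base.Δ.filter (fun β => G.base.ht Sg β = j), G.rs β

/-- The grading of `L` determined by `Sg` is of *Monge type*: the component `𝔤₋₁`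
contains a nonzero abelian subalgebra `Y` of codimension one with
`dim 𝔤₋₂ = dim Y`. -/
def Monge (Sg : Finset V) : Prop :=
  ∃ Y : Submodule ℂ L, Y ≤ G.g Sg (-1) ∧ Y ≠ ⊥ ∧
    (∀ a ∈ Y, ∀ b ∈ Y, ⁅a, b⁆ = (0 : L)) ∧
    Module.finrank ℂ ↥Y + 1 = Module.finrank ℂ ↥(G.g Sg (-1)) ∧
    Module.finrank ℂ ↥(G.g Sg (-2)) = Module.finrank ℂ ↥Y

end GradedLieData


namespace RootSystemBase

variable {V : Type*} [NormedAddCommGroup V] [InnerProductSpace ℝ V]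
variable (R : RootSystemBase V)

theorem coeff_unique {f h : V → ℝ}
    (he : ∑ α ∈ R.Δ0, f α • α = ∑ α ∈ R.Δ0, h α • α) : ∀ α ∈ R.Δ0, f α = h α := by
  have hi := Fintype.linearIndependent_iffₛ.1 R.indep (fun a => f a) (fun a => h a) (by
    rw [Finset.sum_coe_sort R.Δ0 (fun a => f a • a), Finset.sum_coe_sort R.Δ0 (fun a => h a • a)]
    exact he)
  intro α hα
  exact hi ⟨α, hα⟩

theorem coeff_eq {β : V} (hβ : β ∈ R.Δ) (n : V → ℤ) (he : β = ∑ α ∈ R.Δ0, (n α : ℝ) • α) :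
    ∀ α ∈ R.Δ0, R.coeff β α = n α := by
  intro α hα
  have := R.coeff_unique (f := fun α => (R.coeff β α : ℝ)) (h := fun α => (n α : ℝ))
    ((R.coeff_spec β hβ).symm.trans he) α hα
  exact_mod_cast this

theorem ext_coeff {β γ : V} (hβ : β ∈ R.Δ) (hγ : γ ∈ R.Δ)
    (h : ∀ α ∈ R.Δ0, R.coeff β α = R.coeff γ α) : β = γ := by
  rw [R.coeff_spec β hβ, R.coeff_spec γ hγ]
  exact Finset.sum_congr rfl fun α hα => by rw [h α hα]

theorem coeff_simple {a : V} (ha : a ∈ R.Δ0) :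
    ∀ α ∈ R.Δ0, R.coeff a α = if α = a then 1 else 0 := by
  apply R.coeff_eq (R.base_sub ha) (fun α => if α = a then 1 else 0)
  simp [ha]

theorem coeff_neg {β : V} (hβ : β ∈ R.Δ) : ∀ α ∈ R.Δ0, R.coeff (-β) α = - R.coeff β α := by
  apply R.coeff_eq (R.neg_mem β hβ) (fun α => - R.coeff β α)
  conv_lhs => rw [R.coeff_spec β hβ]
  simp

theorem coeff_add {β γ : V} (hβ : β ∈ R.Δ) (hγ : γ ∈ R.Δ) (hs : β + γ ∈ R.Δ) :
    ∀ α ∈ R.Δ0, R.coeff (β + γ) α = R.coeff β α + R.coeff γ α := by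
  apply R.coeff_eq hs (fun α => R.coeff β α + R.coeff γ α)
  conv_lhs => rw [R.coeff_spec β hβ, R.coeff_spec γ hγ]
  simp [add_smul, Finset.sum_add_distrib]

theorem exists_refl {β a : V} (hβ : β ∈ R.Δ) (ha : a ∈ R.Δ0) :
    ∃ k : ℤ, cInt β a = k ∧ β - (k : ℝ) • a ∈ R.Δ ∧
      ∀ α ∈ R.Δ0, R.coeff (β - (k : ℝ) • a) α = R.coeff β α - if α = a then k else 0 := by
  obtain ⟨k, hk⟩ := R.crystal a (R.base_sub ha) β hβ
  have h1 := R.reflect_mem a (R.base_sub ha) β hβ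
  rw [hk] at h1
  refine ⟨k, hk, h1, ?_⟩
  apply R.coeff_eq h1 (fun α => R.coeff β α - if α = a then k else 0)
  conv_lhs => rw [R.coeff_spec β hβ]
  simp [sub_smul, Finset.sum_sub_distrib, ha]

theorem inner_pos {β : V} (hβ : β ∈ R.Δ) : 0 < ⟪β, β⟫ := by
  exact real_inner_self_pos.2 (R.ne_zero β hβ)

theorem cInt_pos_iff {β a : V} (ha : a ∈ R.Δ) : 0 < cInt β a ↔ 0 < ⟪β, a⟫ := by
  have := R.inner_pos ha
  unfold cInt
  rw [div_pos_iff_of_pos_right this]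
  constructor <;> intro <;> linarith

theorem cInt_zero_iff {β a : V} (ha : a ∈ R.Δ) : cInt β a = 0 ↔ ⟪β, a⟫ = 0 := by
  have := R.inner_pos ha
  unfold cInt
  rw [div_eq_zero_iff]
  constructor
  · rintro (h | h) <;> linarith
  · intro h; left; linarith

theorem nonneg_of_pos {β a : V} (hβ : β ∈ R.Δ) (ha : a ∈ R.Δ0) (h : 0 < R.coeff β a) :
    ∀ α ∈ R.Δ0, 0 ≤ R.coeff β α := by
  rcases R.coeff_sign β hβ with h' | h'
  · exact h'
  · exact absurd (h' a ha) (by omega)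

/-- distinct simple roots have non-positive inner product -/
theorem cInt_nonpos {a b : V} (ha : a ∈ R.Δ0) (hb : b ∈ R.Δ0) (hab : a ≠ b) :
    cInt a b ≤ 0 := by
  obtain ⟨k, hk, hm, hc⟩ := R.exists_refl (R.base_sub ha) hb
  have h1 := hc a ha
  have h2 := hc b hb
  rw [R.coeff_simple ha a ha] at h1
  rw [R.coeff_simple ha b hb] at h2
  simp [hab, hab.symm] at h1 h2
  have := R.nonneg_of_pos hm ha (by omega) b hb
  rw [hk]
  exact_mod_cast (by omega : k ≤ 0)

theorem inner_nonpos {a b : V} (ha : a ∈ R.Δ0) (hb : b ∈ R.Δ0) (hab : a ≠ b) :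
    ⟪a, b⟫ ≤ 0 := by
  by_contra! h
  have := (R.cInt_pos_iff (R.base_sub hb)).2 h
  linarith [R.cInt_nonpos ha hb hab]

/-- every root is supported on one of two mutually orthogonal parts of the base -/
theorem support_split {S : Finset V} (hS : S ⊆ R.Δ0)
    (ho : ∀ a ∈ S, ∀ b ∈ R.Δ0, b ∉ S → ⟪a, b⟫ = 0) {β : V} (hβ : β ∈ R.Δ) :
    (∀ α ∈ S, R.coeff β α = 0) ∨ (∀ α ∈ R.Δ0, α ∉ S → R.coeff β α = 0) := by
  have key : ∀ n : ℕ, ∀ β ∈ R.Δ, ∑ α ∈ S, R.coeff β α = n →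
      ∀ s ∈ S, 0 < R.coeff β s → ∀ t ∈ R.Δ0, t ∉ S → 0 < R.coeff β t → False := by
    intro n
    induction n using Nat.strong_induction_on with
    | _ n ih =>
      intro β hβ hn s hs hs0 t ht htS ht0
      have hnn := R.nonneg_of_pos hβ ht ht0
      set βS : V := ∑ α ∈ S, (R.coeff β α : ℝ) • α with hβS
      have hinn : ∀ α ∈ S, ⟪β, α⟫ = ⟪βS, α⟫ := by
        intro α hα
        conv_lhs => rw [R.coeff_spec β hβ]
        rw [hβS, sum_inner, sum_inner]
        symm
        apply Finset.sum_subset hS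
        intro x hx hxS
        rw [inner_smul_left, real_inner_comm, ho α hα x hx hxS]; simp
      have hne : βS ≠ 0 := by
        intro h0
        have := R.coeff_unique (f := fun α => if α ∈ S then (R.coeff β α : ℝ) else 0)
          (h := fun _ => 0) (by
            simp only [ite_smul, zero_smul, Finset.sum_const_zero]
            rw [← Finset.sum_filter, Finset.filter_mem_eq_inter, Finset.inter_eq_right.2 hS]
            exact h0) s (hS hs)
        simp [hs] at this
        omega
      have hpos : 0 < ⟪βS, βS⟫ := real_inner_self_pos.2 hne
      have : ∃ α ∈ S, 0 < ⟪β, α⟫ := by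
        by_contra! hcon
        have : ⟪βS, βS⟫ ≤ 0 := by
          conv_lhs => rw [hβS]
          rw [← hβS, sum_inner]
          apply Finset.sum_nonpos
          intro α hα
          rw [inner_smul_left, real_inner_comm, ← hinn α hα]
          have h1 : (0 : ℝ) ≤ R.coeff β α := by exact_mod_cast hnn α (hS hα)
          exact mul_nonpos_of_nonneg_of_nonpos (by simpa using h1) (hcon α hα)
        linarith
      obtain ⟨α, hα, hαp⟩ := this
      obtain ⟨k, hk, hm, hc⟩ := R.exists_refl hβ (hS hα)
      have hkpos : 0 < k := by
        have := (R.cInt_pos_iff (R.base_sub (hS hα))).2 hαp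
        rw [hk] at this
        exact_mod_cast this
      have hct := hc t ht
      have htα : t ≠ α := fun h => htS (h ▸ hα)
      simp only [htα, if_false] at hct
      have hnn' := R.nonneg_of_pos hm ht (by omega)
      have hsum : ∑ x ∈ S, R.coeff (β - (k : ℝ) • α) x = n - k := by
        rw [Finset.sum_congr rfl fun x hx => hc x (hS hx), Finset.sum_sub_distrib, hn]
        simp [hα]
      have hnk : 0 ≤ (n : ℤ) - k := by
        rw [← hsum]; exact Finset.sum_nonneg fun x hx => hnn' x (hS hx)
      have hexs : ∃ s' ∈ S, 0 < R.coeff (β - (k : ℝ) • α) s' := by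
        by_contra! hcon
        have hz : ∀ x ∈ S, x ≠ α → R.coeff β x = 0 := by
          intro x hx hxa
          have h1 := hc x (hS hx)
          have h2 := hcon x hx
          have h3 := hnn' x (hS hx)
          simp only [hxa, if_false] at h1
          omega
        have hb : βS = (R.coeff β α : ℝ) • α := by
          rw [hβS]
          apply Finset.sum_eq_single_of_mem α hα
          intro x hx hxa
          rw [hz x hx hxa]; simp
        have hk2 : (k : ℝ) = 2 * R.coeff β α := by
          rw [← hk]
          unfold cInt
          rw [hinn α hα, hb, inner_smul_left]
          have := R.inner_pos (R.base_sub (hS hα))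
          field_simp
          simp
        have hk2' : k = 2 * R.coeff β α := by exact_mod_cast hk2
        have h1 := hc α (hS hα)
        have h3 := hnn' α (hS hα)
        simp only [if_true] at h1
        omega
      obtain ⟨s', hs', hs'0⟩ := hexs
      refine ih (n - k).toNat (by omega) _ hm (by rw [hsum]; omega) s' hs' hs'0 t ht htS (by omega)
  have key2 : ∀ β ∈ R.Δ, ∀ s ∈ S, 0 < R.coeff β s → ∀ t ∈ R.Δ0, t ∉ S → 0 < R.coeff β t → False := by
    intro β hβ s hs hs0
    have hnn := R.nonneg_of_pos hβ (hS hs) hs0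
    have h0 : 0 ≤ ∑ α ∈ S, R.coeff β α := Finset.sum_nonneg fun x hx => hnn x (hS hx)
    exact key (∑ α ∈ S, R.coeff β α).toNat β hβ (by omega) s hs hs0
  by_contra! hcon
  obtain ⟨⟨s, hs, hs0⟩, t, ht, htS, ht0⟩ := hcon
  rcases R.coeff_sign β hβ with h | h
  · have h1 := h s (hS hs)
    have h2 := h t ht
    exact key2 β hβ s hs (by omega) t ht htS (by omega)
  · have h1 := h s (hS hs)
    have h2 := h t ht
    have h3 := R.coeff_neg hβ s (hS hs)
    have h4 := R.coeff_neg hβ t ht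
    exact key2 (-β) (R.neg_mem β hβ) s hs (by omega) t ht htS (by omega)

end RootSystemBase

namespace GradedLieData

variable {V : Type*} [NormedAddCommGroup V] [InnerProductSpace ℝ V]
variable {L : Type*} [LieRing L] [LieAlgebra ℂ L]

variable (G : GradedLieData V L)

theorem toH_sum (s : Finset V) (n : V → ℤ) :
    G.toH (∑ α ∈ s, (n α : ℝ) • α) = ∑ α ∈ s, n α • G.toH α := by
  let f : V →+ L := AddMonoidHom.mk' G.toH G.toH_add
  change f _ = ∑ α ∈ s, n α • f α
  rw [map_sum]
  refine Finset.sum_congr rfl fun α _ => ?_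
  rw [← map_zsmul, Int.cast_smul_eq_zsmul]

theorem lie_mem_span {X M : Set L} (hX : Submodule.span ℂ X = ⊤)
    (h : ∀ x ∈ X, ∀ m ∈ M, ⁅x, m⁆ ∈ Submodule.span ℂ M) (x : L) {m : L}
    (hm : m ∈ Submodule.span ℂ M) : ⁅x, m⁆ ∈ Submodule.span ℂ M := by
  have hx : x ∈ Submodule.span ℂ X := hX ▸ Submodule.mem_top
  induction hm using Submodule.span_induction with
  | mem m hm =>
    induction hx using Submodule.span_induction with
    | mem x hx => exact h x hx m hm
    | zero => simp
    | add x y _ _ h1 h2 => rw [add_lie]; exact add_mem h1 h2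
    | smul c x _ h1 => rw [smul_lie]; exact Submodule.smul_mem _ _ h1
  | zero => simp
  | add x y _ _ h1 h2 => rw [lie_add]; exact add_mem h1 h2
  | smul c x _ h1 => rw [lie_smul]; exact Submodule.smul_mem _ _ h1

theorem irred (hsimp : LieAlgebra.IsSimple ℂ L) : G.base.Irred := by
  rintro ⟨S, hS, ⟨s, hs⟩, hne, ho⟩
  obtain ⟨t, ht, htS⟩ : ∃ t ∈ G.base.Δ0, t ∉ S := by
    by_contra! h
    exact hne (Finset.Subset.antisymm hS h)
  let P : V → Prop := fun β => β ∈ G.base.Δ ∧ ∀ α ∈ G.base.Δ0, α ∉ S → G.base.coeff β α = 0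
  let M : Set L := {x | ∃ β, P β ∧ x ∈ G.rs β} ∪ G.toH '' S
  let X : Set L := (G.H : Set L) ∪ {x | ∃ β ∈ G.base.Δ, x ∈ G.rs β}
  have hX : Submodule.span ℂ X = ⊤ := by
    rw [eq_top_iff, ← G.sup_eq_top]
    refine sup_le (fun x hx => Submodule.subset_span (Or.inl hx)) ?_
    refine iSup₂_le fun β hβ x hx => Submodule.subset_span (Or.inr ⟨β, hβ, hx⟩)
  have hPmem : ∀ β, P β → ∀ x ∈ G.rs β, x ∈ Submodule.span ℂ M :=
    fun β hβ x hx => Submodule.subset_span (Or.inl ⟨β, hβ, hx⟩)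
  have htoH : ∀ β, P β → G.toH β ∈ Submodule.span ℂ M := by
    intro β hβ
    rw [G.base.coeff_spec β hβ.1, toH_sum]
    refine Submodule.sum_mem _ fun α hα => ?_
    by_cases hαS : α ∈ S
    · have hmem : G.toH α ∈ Submodule.span ℂ M := Submodule.subset_span (Or.inr ⟨α, hαS, rfl⟩)
      exact zsmul_mem hmem _
    · rw [hβ.2 α hα hαS]; simp
  have hnP : ∀ γ ∈ G.base.Δ, ¬ P γ → ∀ α ∈ S, G.base.coeff γ α = 0 := by
    intro γ hγ hnp
    rcases G.base.support_split hS ho hγ with h | h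
    · exact h
    · exact absurd ⟨hγ, h⟩ hnp
  have hzero : ∀ β ∈ G.base.Δ, (∀ α ∈ S, G.base.coeff β α = 0) → 
      (∀ α ∈ G.base.Δ0, α ∉ S → G.base.coeff β α = 0) → False := by
    intro β hβ h1 h2
    apply G.base.ne_zero β hβ
    rw [G.base.coeff_spec β hβ]
    refine Finset.sum_eq_zero fun α hα => ?_
    by_cases h : α ∈ S
    · simp [h1 α h]
    · simp [h2 α hα h]
  have hlie : ∀ x ∈ X, ∀ m ∈ M, ⁅x, m⁆ ∈ Submodule.span ℂ M := by
    rintro x (hx | ⟨γ, hγ, hx⟩) m (⟨β, hβ, hm⟩ | ⟨α, hα, rfl⟩)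
    · exact hPmem β hβ _ (G.br_h_rs β hβ.1 x hx m hm)
    · rw [G.br_h_h x hx _ (G.toH_mem α)]; exact zero_mem _
    · by_cases hs : γ + β ∈ G.base.Δ
      · by_cases hPγ : P γ
        · refine hPmem (γ + β) ⟨hs, fun α hα hαS => ?_⟩ _ (G.br_rs_mem γ hγ β hβ.1 hs x hx m hm)
          rw [G.base.coeff_add hγ hβ.1 hs α hα, hPγ.2 α hα hαS, hβ.2 α hα hαS]; rfl
        · exfalso
          have h1 := hnP γ hγ hPγ
          have hadd := G.base.coeff_add hγ hβ.1 hs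
          rcases G.base.support_split hS ho hs with h | h
          · refine hzero β hβ.1 (fun α hα => ?_) hβ.2
            have := hadd α (hS hα)
            rw [h α hα, h1 α hα] at this
            omega
          · refine hzero γ hγ h1 fun α hα hαS => ?_
            have := hadd α hα
            rw [h α hα hαS, hβ.2 α hα hαS] at this
            omega
      · by_cases h0 : γ + β = 0
        · have hγβ : γ = -β := eq_neg_of_add_eq_zero_left h0
          rw [hγβ] at hx
          rw [← lie_skew]
          refine neg_mem ?_
          have := G.br_rs_opp β hβ.1 m hm x hx
          refine Submodule.span_le.2 ?_ this
          rintro _ rfl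
          exact htoH β hβ
        · rw [G.br_rs_zero γ hγ β hβ.1 hs h0 x hx m hm]; exact zero_mem _
    · rw [← lie_skew, G.br_toH α γ hγ x hx]
      by_cases hPγ : P γ
      · exact neg_mem (Submodule.smul_mem _ _ (hPmem γ hPγ x hx))
      · have h1 := hnP γ hγ hPγ
        have : ⟪γ, α⟫ = 0 := by
          rw [G.base.coeff_spec γ hγ, sum_inner]
          refine Finset.sum_eq_zero fun δ hδ => ?_
          by_cases h : δ ∈ S
          · simp [h1 δ h]
          · rw [inner_smul_left, real_inner_comm, ho α hα δ hδ h]; simp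
        rw [this]; simp
  let I : LieIdeal ℂ L := { Submodule.span ℂ M with
    lie_mem := fun {x m} hm => lie_mem_span hX hlie x hm }
  have hI : ∀ x, x ∈ I ↔ x ∈ Submodule.span ℂ M := fun x => Iff.rfl
  have hsP : P s := by
    refine ⟨G.base.base_sub (hS hs), fun α hα hαS => ?_⟩
    rw [G.base.coeff_simple (hS hs) α hα, if_neg]
    rintro rfl; exact hαS hs
  have hrs : ∀ β ∈ G.base.Δ, G.rs β ≠ ⊥ := by
    intro β hβ h
    have := G.rs_dim β hβ
    rw [h] at this
    simp at this
  rcases hsimp.eq_bot_or_eq_top I with h | h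
  · apply hrs s hsP.1
    rw [eq_bot_iff]
    intro x hx
    have : x ∈ I := (hI x).2 (hPmem s hsP x hx)
    rw [h] at this
    simpa using this
  · have htΔ := G.base.base_sub ht
    apply hrs t htΔ
    have hle : Submodule.span ℂ M ≤ G.H ⊔ ⨆ γ ∈ G.base.Δ.erase t, G.rs γ := by
      refine Submodule.span_le.2 ?_
      rintro x (⟨β, hβ, hx⟩ | ⟨α, hα, rfl⟩)
      · refine Submodule.mem_sup_right ?_
        refine Submodule.mem_iSup_of_mem β (Submodule.mem_iSup_of_mem ?_ hx)
        refine Finset.mem_erase.2 ⟨?_, hβ.1⟩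
        rintro rfl
        have := hβ.2 β ht htS
        rw [G.base.coeff_simple ht β ht] at this
        simp at this
      · exact Submodule.mem_sup_left (G.toH_mem α)
    rw [eq_bot_iff]
    refine G.rs_indep t htΔ le_rfl fun x _ => hle ((hI x).1 ?_)
    rw [h]; exact LieSubmodule.mem_top x

theorem finrank_iSup [FiniteDimensional ℂ L] (F : Finset V) (hF : F ⊆ G.base.Δ) :
    Module.finrank ℂ ↥(⨆ β ∈ F, G.rs β) = F.card := by
  induction F using Finset.induction_on with
  | empty => simp
  | insert a F ha ih =>
    have ha' : a ∈ G.base.Δ := hF (Finset.mem_insert_self a F)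
    have hF' : F ⊆ G.base.Δ := fun x hx => hF (Finset.mem_insert_of_mem hx)
    rw [Finset.iSup_insert, Finset.card_insert_of_notMem ha, ← ih hF']
    have h1 := Submodule.finrank_sup_add_finrank_inf_eq (G.rs a) (⨆ β ∈ F, G.rs β)
    have h2 : Disjoint (G.rs a) (⨆ β ∈ F, G.rs β) := by
      refine (G.rs_indep a ha').mono_right (le_sup_of_le_right ?_)
      refine iSup₂_le fun β hβ => ?_
      refine le_iSup₂_of_le β (Finset.mem_erase.2 ⟨?_, hF' hβ⟩) le_rfl
      rintro rfl; exact ha hβ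
    rw [h2.eq_bot, G.rs_dim a ha'] at h1
    simp at h1
    omega

/-- roots of height `j` -/
noncomputable def F (Sg : Finset V) (j : ℤ) : Finset V :=
  G.base.Δ.filter (fun β => G.base.ht Sg β = j)

theorem mem_F {Sg : Finset V} {j : ℤ} {β : V} :
    β ∈ G.F Sg j ↔ β ∈ G.base.Δ ∧ G.base.ht Sg β = j := by
  simp [F]

theorem ht_neg {Sg : Finset V} (hSg : Sg ⊆ G.base.Δ0) {β : V} (hβ : β ∈ G.base.Δ) :
    G.base.ht Sg (-β) = - G.base.ht Sg β := by
  unfold RootSystemBase.ht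
  rw [← Finset.sum_neg_distrib]
  exact Finset.sum_congr rfl fun α hα => G.base.coeff_neg hβ α (hSg hα)

theorem finrank_g [FiniteDimensional ℂ L] {Sg : Finset V} (hSg : Sg ⊆ G.base.Δ0) {j : ℤ} (hj : j ≠ 0) :
    Module.finrank ℂ ↥(G.g Sg (-j)) = (G.F Sg j).card := by
  have h1 : G.g Sg (-j) = ⨆ β ∈ G.F Sg (-j), G.rs β := by
    unfold g F
    rw [if_neg (by omega)]
  rw [h1, finrank_iSup G (G.F Sg (-j)) (Finset.filter_subset _ _)]
  refine Finset.card_bij' (fun β _ => -β) (fun β _ => -β) ?_ ?_ ?_ ?_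
  · intro β hβ
    rw [mem_F] at hβ ⊢
    exact ⟨G.base.neg_mem β hβ.1, by rw [ht_neg G hSg hβ.1]; omega⟩
  · intro β hβ
    rw [mem_F] at hβ ⊢
    exact ⟨G.base.neg_mem β hβ.1, by rw [ht_neg G hSg hβ.1]; omega⟩
  · simp
  · simp

theorem ht_simple {Sg : Finset V} (hSg : Sg ⊆ G.base.Δ0) {a : V} (ha : a ∈ Sg) :
    G.base.ht Sg a = 1 := by
  unfold RootSystemBase.ht
  rw [Finset.sum_congr rfl fun α hα => G.base.coeff_simple (hSg ha) α (hSg hα)]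
  simp [ha]

theorem monge_iff [FiniteDimensional ℂ L] {Sg : Finset V} (hSg : Sg ⊆ G.base.Δ0) (hne : Sg.Nonempty) :
    (G.Monge Sg ∧ Module.finrank ℂ ↥(G.g Sg (-1)) = 2) ↔
      (G.F Sg 1).card = 2 ∧ (G.F Sg 2).card = 1 := by
  rw [← finrank_g G hSg one_ne_zero, ← finrank_g G hSg two_ne_zero]
  constructor
  · rintro ⟨⟨Y, -, -, -, h1, h2⟩, h3⟩
    exact ⟨h3, by omega⟩
  · rintro ⟨h1, h2⟩
    refine ⟨?_, h1⟩
    obtain ⟨a, ha⟩ := hne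
    have haΔ := G.base.neg_mem a (G.base.base_sub (hSg ha))
    have hd := G.rs_dim (-a) haΔ
    refine ⟨G.rs (-a), ?_, ?_, ?_, by omega, by omega⟩
    · unfold g
      rw [if_neg (by omega)]
      refine le_iSup₂_of_le (-a) ?_ le_rfl
      simp only [Finset.mem_filter]
      exact ⟨haΔ, by rw [ht_neg G hSg (G.base.base_sub (hSg ha)), ht_simple G hSg ha]⟩
    · intro h
      rw [h] at hd
      simp at hd
    · obtain ⟨v, -, hv⟩ := finrank_eq_one_iff'.1 hd
      intro x hx y hy
      obtain ⟨c, hc⟩ := hv ⟨x, hx⟩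
      obtain ⟨d, hd⟩ := hv ⟨y, hy⟩
      have hc' : c • (v : L) = x := congrArg Subtype.val hc
      have hd' : d • (v : L) = y := congrArg Subtype.val hd
      rw [← hc', ← hd']
      simp

end GradedLieData

namespace RootSystemBase

variable {V : Type*} [NormedAddCommGroup V] [InnerProductSpace ℝ V]
variable (R : RootSystemBase V)

theorem cartan_pairs {a b : V} (ha : a ∈ R.Δ0) (hb : b ∈ R.Δ0) (hab : a ≠ b) (h0 : ⟪a, b⟫ ≠ 0) :
    (cInt a b = -1 ∧ cInt b a = -1) ∨ (cInt a b = -1 ∧ cInt b a = -2) ∨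
    (cInt a b = -1 ∧ cInt b a = -3) ∨ (cInt a b = -2 ∧ cInt b a = -1) ∨
    (cInt a b = -3 ∧ cInt b a = -1) := by
  have haΔ := R.base_sub ha
  have hbΔ := R.base_sub hb
  obtain ⟨k, hk, -, -⟩ := R.exists_refl haΔ hb
  obtain ⟨l, hl, -, -⟩ := R.exists_refl hbΔ ha
  have hk0 := R.cInt_nonpos ha hb hab
  have hl0 := R.cInt_nonpos hb ha hab.symm
  have hk1 : cInt a b ≠ 0 := fun h => h0 ((R.cInt_zero_iff hbΔ).1 h)
  have hl1 : cInt b a ≠ 0 := fun h => h0 (by rw [real_inner_comm]; exact (R.cInt_zero_iff haΔ).1 h)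
  have hpa := R.inner_pos haΔ
  have hpb := R.inner_pos hbΔ
  have hkl : cInt a b * cInt b a < 4 := by
    have hw : (⟪b, b⟫ • a - ⟪a, b⟫ • b : V) ≠ 0 := by
      intro h
      have := R.coeff_unique (f := fun α => (if α = a then ⟪b, b⟫ else 0) + (if α = b then -⟪a, b⟫ else 0))
        (h := fun _ => 0) (by
          simp only [add_smul, ite_smul, zero_smul, Finset.sum_const_zero, Finset.sum_add_distrib,
            Finset.sum_ite_eq', ha, hb, if_true, neg_smul]
          rw [← sub_eq_add_neg]; exact h) a ha
      simp [hab] at this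
      exact R.ne_zero b hbΔ this
    have hpos := real_inner_self_pos.2 hw
    have hexp : ⟪(⟪b, b⟫ • a - ⟪a, b⟫ • b : V), ⟪b, b⟫ • a - ⟪a, b⟫ • b⟫
        = ⟪b, b⟫ * (⟪a, a⟫ * ⟪b, b⟫ - ⟪a, b⟫ * ⟪a, b⟫) := by
      simp only [inner_sub_left, inner_sub_right, real_inner_smul_left, real_inner_smul_right]
      rw [real_inner_comm a b]
      ring
    rw [hexp] at hpos
    have h2 := (pos_iff_pos_of_mul_pos hpos).1 hpb
    unfold cInt
    rw [div_mul_div_comm, div_lt_iff₀ (by positivity), real_inner_comm a b]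
    nlinarith
  rw [hk] at hk0 hk1 hkl ⊢
  rw [hl] at hl0 hl1 hkl ⊢
  have hk0 : k ≤ 0 := by exact_mod_cast hk0
  have hl0 : l ≤ 0 := by exact_mod_cast hl0
  have hk1 : k ≠ 0 := by exact_mod_cast hk1
  have hl1 : l ≠ 0 := by exact_mod_cast hl1
  have hkl : k * l < 4 := by exact_mod_cast hkl
  have hk3 : -3 ≤ k := by nlinarith [show k ≤ -1 by omega, show l ≤ -1 by omega]
  have hl3 : -3 ≤ l := by nlinarith [show k ≤ -1 by omega, show l ≤ -1 by omega]
  have : (k = -1 ∧ l = -1) ∨ (k = -1 ∧ l = -2) ∨ (k = -1 ∧ l = -3) ∨ (k = -2 ∧ l = -1) ∨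
      (k = -3 ∧ l = -1) := by
    interval_cases k <;> interval_cases l <;> omega
  rcases this with ⟨rfl, rfl⟩ | ⟨rfl, rfl⟩ | ⟨rfl, rfl⟩ | ⟨rfl, rfl⟩ | ⟨rfl, rfl⟩ <;> norm_num

/-- `n a + m b` is a root -/
def P (a b : V) (n m : ℤ) : Prop := (n : ℝ) • a + (m : ℝ) • b ∈ R.Δ

variable {R}
variable {a b : V}

theorem P_swap {n m : ℤ} : R.P a b n m ↔ R.P b a m n := by
  unfold P; rw [add_comm]

theorem P_coeff (hab : a ≠ b) (h0 : R.Δ0 = {a, b}) {n m : ℤ} (h : R.P a b n m) :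
    R.coeff ((n : ℝ) • a + (m : ℝ) • b) a = n ∧ R.coeff ((n : ℝ) • a + (m : ℝ) • b) b = m := by
  have := R.coeff_eq h (fun α => if α = a then n else m) (by
    rw [h0, Finset.sum_pair hab]; simp [hab.symm])
  have h1 := this a (by simp [h0])
  have h2 := this b (by simp [h0])
  simp [hab.symm] at h1 h2
  exact ⟨h1, h2⟩

theorem P_rep (hab : a ≠ b) (h0 : R.Δ0 = {a, b}) {β : V} (h : β ∈ R.Δ) :
    β = (R.coeff β a : ℝ) • a + (R.coeff β b : ℝ) • b := by
  conv_lhs => rw [R.coeff_spec β h]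
  rw [h0, Finset.sum_pair hab]

theorem P_sign (hab : a ≠ b) (h0 : R.Δ0 = {a, b}) {n m : ℤ} (h : R.P a b n m) :
    (0 ≤ n ∧ 0 ≤ m) ∨ (n ≤ 0 ∧ m ≤ 0) := by
  obtain ⟨h1, h2⟩ := P_coeff hab h0 h
  rcases R.coeff_sign _ h with h' | h'
  · left; exact ⟨by simpa [h1] using h' a (by simp [h0]), by simpa [h2] using h' b (by simp [h0])⟩
  · right; exact ⟨by simpa [h1] using h' a (by simp [h0]), by simpa [h2] using h' b (by simp [h0])⟩

theorem P_refl (h0 : R.Δ0 = {a, b}) {n m l : ℤ} (hl : cInt b a = l) (h : R.P a b n m) :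
    R.P a b (-n - m * l) m := by
  have ha : a ∈ R.Δ0 := by simp [h0]
  obtain ⟨k, hk, hm, -⟩ := R.exists_refl h ha
  have hk' : (k : ℝ) = 2 * n + m * l := by
    rw [← hk, ← hl]
    have := R.inner_pos (R.base_sub ha)
    unfold cInt
    rw [inner_add_left, real_inner_smul_left, real_inner_smul_left]
    field_simp
  unfold P
  convert hm using 1
  rw [hk']
  push_cast
  module

theorem P_one (h0 : R.Δ0 = {a, b}) : R.P a b 1 0 := by
  unfold P; simpa using R.base_sub (show a ∈ R.Δ0 by simp [h0])

theorem P_double {n m : ℤ} (h : R.P a b n m) : ¬ R.P a b (2 * n) (2 * m) := by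
  intro h2
  apply R.reduced _ h
  unfold P at h2
  convert h2 using 1
  push_cast
  module

theorem P_not20 (h0 : R.Δ0 = {a, b}) : ¬ R.P a b 2 0 := P_double (P_one h0)

theorem P_zero : ¬ R.P a b 0 0 := by
  intro h
  exact R.ne_zero _ h (by simp)

theorem P_ne (hab : a ≠ b) (h0 : R.Δ0 = {a, b}) {n m n' m' : ℤ} (h : R.P a b n m)
    (h' : R.P a b n' m') (hne : m ≠ m') :
    (n : ℝ) • a + (m : ℝ) • b ≠ (n' : ℝ) • a + (m' : ℝ) • b := by
  intro he
  apply hne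
  rw [← (P_coeff hab h0 h).2, he, (P_coeff hab h0 h').2]

end RootSystemBase

namespace GradedLieData

open RootSystemBase

variable {V : Type*} [NormedAddCommGroup V] [InnerProductSpace ℝ V]
variable {L : Type*} [LieRing L] [LieAlgebra ℂ L]
variable {G : GradedLieData V L} {a b : V}

theorem mem_F_single (hab : a ≠ b) (h0 : G.base.Δ0 = {a, b}) {j : ℤ} {β : V} :
    β ∈ G.F {a} j ↔ ∃ m : ℤ, G.base.P a b j m ∧ β = (j : ℝ) • a + (m : ℝ) • b := by
  rw [mem_F]
  constructor
  · rintro ⟨h, h'⟩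
    simp [RootSystemBase.ht] at h'
    have := P_rep hab h0 h
    rw [h'] at this
    refine ⟨_, ?_, this⟩
    unfold P; rw [← this]; exact h
  · rintro ⟨m, h, rfl⟩
    refine ⟨h, ?_⟩
    simpa [RootSystemBase.ht] using (P_coeff hab h0 h).1

theorem mem_F_pair (hab : a ≠ b) (h0 : G.base.Δ0 = {a, b}) {j : ℤ} {β : V} :
    β ∈ G.F {a, b} j ↔
      ∃ n m : ℤ, n + m = j ∧ G.base.P a b n m ∧ β = (n : ℝ) • a + (m : ℝ) • b := by
  rw [mem_F]
  constructor
  · rintro ⟨h, h'⟩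
    simp only [RootSystemBase.ht, Finset.sum_pair hab] at h'
    have := P_rep hab h0 h
    refine ⟨_, _, h', ?_, this⟩
    unfold P; rw [← this]; exact h
  · rintro ⟨n, m, hj, h, rfl⟩
    refine ⟨h, ?_⟩
    simp only [RootSystemBase.ht, Finset.sum_pair hab, P_coeff hab h0 h]
    exact hj

theorem pair_card (hab : a ≠ b) (h0 : G.base.Δ0 = {a, b}) (hk : cInt a b = -1) :
    (G.F {a, b} 1).card = 2 ∧ (G.F {a, b} 2).card = 1 := by
  have h0' : G.base.Δ0 = {b, a} := by rw [h0, Finset.pair_comm]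
  have h10 : G.base.P a b 1 0 := P_one h0
  have h01 : G.base.P a b 0 1 := P_swap.2 (P_one h0')
  have h11 : G.base.P a b 1 1 := by
    have := P_refl h0' (l := -1) (by rw [hk]; norm_num) (P_swap.1 h10)
    exact P_swap.2 (by simpa using this)
  have h20 : ¬ G.base.P a b 2 0 := P_not20 h0
  have h02 : ¬ G.base.P a b 0 2 := fun h => P_not20 h0' (P_swap.1 h)
  constructor
  · rw [Finset.card_eq_two]
    refine ⟨_, _, P_ne hab h0 h10 h01 (by norm_num), ?_⟩
    ext β
    rw [mem_F_pair hab h0, Finset.mem_insert, Finset.mem_singleton]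
    constructor
    · rintro ⟨n, m, hnm, h, rfl⟩
      have := P_sign hab h0 h
      obtain ⟨rfl, rfl⟩ | ⟨rfl, rfl⟩ : (n = 1 ∧ m = 0) ∨ (n = 0 ∧ m = 1) := by omega
      · left; rfl
      · right; rfl
    · rintro (rfl | rfl)
      · exact ⟨1, 0, by norm_num, h10, rfl⟩
      · exact ⟨0, 1, by norm_num, h01, rfl⟩
  · rw [Finset.card_eq_one]
    refine ⟨((1 : ℤ) : ℝ) • a + ((1 : ℤ) : ℝ) • b, ?_⟩
    ext β
    rw [mem_F_pair hab h0, Finset.mem_singleton]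
    constructor
    · rintro ⟨n, m, hnm, h, rfl⟩
      have := P_sign hab h0 h
      obtain ⟨rfl, rfl⟩ | ⟨rfl, rfl⟩ | ⟨rfl, rfl⟩ :
        (n = 1 ∧ m = 1) ∨ (n = 0 ∧ m = 2) ∨ (n = 2 ∧ m = 0) := by omega
      · rfl
      · exact absurd h h02
      · exact absurd h h20
    · rintro rfl
      exact ⟨1, 1, by norm_num, h11, rfl⟩

/-- roots `2 a + m b` when `⟨a, b⟩ = -1` -/
theorem two_only (hab : a ≠ b) (h0 : G.base.Δ0 = {a, b}) (hk : cInt a b = -1) {m : ℤ}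
    (h : G.base.P a b 2 m) : m = 1 := by
  have h0' : G.base.Δ0 = {b, a} := by rw [h0, Finset.pair_comm]
  have h10 : G.base.P a b 1 0 := P_one h0
  have h11 : G.base.P a b 1 1 := by
    have := P_refl h0' (l := -1) (by rw [hk]; norm_num) (P_swap.1 h10)
    exact P_swap.2 (by simpa using this)
  have h20 : ¬ G.base.P a b 2 0 := P_not20 h0
  have h22 : ¬ G.base.P a b 2 2 := P_double h11
  have h' := P_swap.2 (P_refl h0' (l := -1) (by rw [hk]; norm_num) (P_swap.1 h))
  have s1 := P_sign hab h0 h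
  have s2 := P_sign hab h0 h'
  have : m = 0 ∨ m = 1 ∨ m = 2 := by omega
  rcases this with rfl | rfl | rfl
  · exact absurd h h20
  · rfl
  · exact absurd h h22

theorem single_card (hab : a ≠ b) (h0 : G.base.Δ0 = {a, b}) (hk : cInt a b = -1)
    (hl : cInt b a = -2 ∨ cInt b a = -3) :
    (G.F {a} 1).card = 2 ∧ (G.F {a} 2).card = 1 := by
  have h0' : G.base.Δ0 = {b, a} := by rw [h0, Finset.pair_comm]
  have h10 : G.base.P a b 1 0 := P_one h0
  have h01 : G.base.P a b 0 1 := P_swap.2 (P_one h0')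
  have h11 : G.base.P a b 1 1 := by
    have := P_refl h0' (l := -1) (by rw [hk]; norm_num) (P_swap.1 h10)
    exact P_swap.2 (by simpa using this)
  have h21 : G.base.P a b 2 1 := by
    rcases hl with hl | hl
    · simpa using P_refl h0 (l := -2) (by rw [hl]; norm_num) h01
    · simpa using P_refl h0 (l := -3) (by rw [hl]; norm_num) h11
  constructor
  · rw [Finset.card_eq_two]
    refine ⟨_, _, P_ne hab h0 h10 h11 (by norm_num), ?_⟩
    ext β
    rw [mem_F_single hab h0, Finset.mem_insert, Finset.mem_singleton]
    constructor
    · rintro ⟨m, h, rfl⟩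
      have h' := P_swap.2 (P_refl h0' (l := -1) (by rw [hk]; norm_num) (P_swap.1 h))
      have s1 := P_sign hab h0 h
      have s2 := P_sign hab h0 h'
      obtain rfl | rfl : m = 0 ∨ m = 1 := by omega
      · left; rfl
      · right; rfl
    · rintro (rfl | rfl)
      · exact ⟨0, h10, rfl⟩
      · exact ⟨1, h11, rfl⟩
  · rw [Finset.card_eq_one]
    refine ⟨((2 : ℤ) : ℝ) • a + ((1 : ℤ) : ℝ) • b, ?_⟩
    ext β
    rw [mem_F_single hab h0, Finset.mem_singleton]
    constructor
    · rintro ⟨m, h, rfl⟩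
      rw [two_only hab h0 hk h]
    · rintro rfl
      exact ⟨1, h21, rfl⟩

theorem single_A2 (hab : a ≠ b) (h0 : G.base.Δ0 = {a, b}) (hk : cInt a b = -1)
    (hl : cInt b a = -1) (h2 : (G.F {a} 2).card = 1) : False := by
  obtain ⟨β, hβ⟩ := Finset.card_eq_one.1 h2
  have hβ' : β ∈ G.F {a} 2 := by rw [hβ]; simp
  obtain ⟨m, hm, -⟩ := (mem_F_single hab h0).1 hβ'
  obtain rfl := two_only hab h0 hk hm
  have h' := P_refl h0 (l := -1) (by rw [hl]; norm_num) hm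
  have := P_sign hab h0 h'
  omega

theorem no_third {F : Finset V} (hF : F.card = 2) {x y z : V} (hx : x ∈ F) (hy : y ∈ F)
    (hz : z ∈ F) (hxy : x ≠ y) (hxz : x ≠ z) (hyz : y ≠ z) : False := by
  have : 2 < F.card := Finset.two_lt_card.2 ⟨x, hx, y, hy, z, hz, hxy, hxz, hyz⟩
  omega

theorem single_k (hab : a ≠ b) (h0 : G.base.Δ0 = {a, b}) (hk : cInt a b = -2 ∨ cInt a b = -3)
    (hl : cInt b a = -1) (h1 : (G.F {a} 1).card = 2) : False := by
  have h0' : G.base.Δ0 = {b, a} := by rw [h0, Finset.pair_comm]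
  have h10 : G.base.P a b 1 0 := P_one h0
  have h01 : G.base.P a b 0 1 := P_swap.2 (P_one h0')
  have h11 : G.base.P a b 1 1 := by
    simpa using P_refl h0 (l := -1) (by rw [hl]; norm_num) h01
  obtain ⟨m, hm, hm2⟩ : ∃ m : ℤ, G.base.P a b 1 m ∧ 2 ≤ m := by
    rcases hk with hk | hk
    · exact ⟨2, by simpa using P_swap.2 (P_refl h0' (l := -2) (by rw [hk]; norm_num) (P_swap.1 h10)), by norm_num⟩
    · exact ⟨3, by simpa using P_swap.2 (P_refl h0' (l := -3) (by rw [hk]; norm_num) (P_swap.1 h10)), by norm_num⟩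
  exact no_third h1 ((mem_F_single hab h0).2 ⟨0, h10, rfl⟩) ((mem_F_single hab h0).2 ⟨1, h11, rfl⟩)
    ((mem_F_single hab h0).2 ⟨m, hm, rfl⟩) (P_ne hab h0 h10 h11 (by norm_num))
    (P_ne hab h0 h10 hm (by omega)) (P_ne hab h0 h11 hm (by omega))

/-- reflecting in a simple root outside `Sg` preserves the height; if the pairing is nonzero
the coefficient changes -/
theorem refl_F {Sg : Finset V} (hSg : Sg ⊆ G.base.Δ0) {j : ℤ} {β d : V} (hβ : β ∈ G.F Sg j)
    (hd : d ∈ G.base.Δ0) (hdS : d ∉ Sg) (hne : ⟪β, d⟫ ≠ 0) :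
    ∃ k : ℤ, k ≠ 0 ∧ β - (k : ℝ) • d ∈ G.F Sg j ∧
      ∀ α ∈ G.base.Δ0, G.base.coeff (β - (k : ℝ) • d) α = G.base.coeff β α - if α = d then k else 0 := by
  rw [mem_F] at hβ
  obtain ⟨k, hk, hm, hc⟩ := G.base.exists_refl hβ.1 hd
  refine ⟨k, ?_, ?_, hc⟩
  · rintro rfl
    exact hne ((G.base.cInt_zero_iff (G.base.base_sub hd)).1 (by rw [hk]; norm_num))
  · rw [mem_F]
    refine ⟨hm, ?_⟩
    rw [← hβ.2]
    unfold RootSystemBase.ht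
    refine Finset.sum_congr rfl fun α hα => ?_
    rw [hc α (hSg hα), if_neg (show α ≠ d from fun h => hdS (h ▸ hα)), sub_zero]

theorem forward (hirr : G.base.Irred) {Sg : Finset V} (hSg : Sg ⊆ G.base.Δ0) (hne : Sg.Nonempty)
    (h1 : (G.F Sg 1).card = 2) (h2 : (G.F Sg 2).card = 1) :
    ∃ a b : V, a ≠ b ∧ G.base.Δ0 = {a, b} ∧ ⟪a, b⟫ ≠ 0 ∧ (Sg = {a} ∨ Sg = {a, b}) := by
  have hsub : Sg ⊆ G.F Sg 1 := fun x hx =>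
    (mem_F G).2 ⟨G.base.base_sub (hSg hx), ht_simple G hSg hx⟩
  have hcard : Sg.card ≤ 2 := h1 ▸ Finset.card_le_card hsub
  have hpos : 0 < Sg.card := hne.card_pos
  have hirr' : ∀ S : Finset V, S ⊆ G.base.Δ0 → S.Nonempty →
      (∀ a ∈ S, ∀ b ∈ G.base.Δ0, b ∉ S → ⟪a, b⟫ = 0) → S = G.base.Δ0 := by
    intro S hS hn h
    by_contra hne
    exact hirr ⟨S, hS, hn, hne, h⟩
  obtain hc | hc : Sg.card = 1 ∨ Sg.card = 2 := by omega
  · obtain ⟨a, rfl⟩ := Finset.card_eq_one.1 hc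
    have ha : a ∈ G.base.Δ0 := hSg (by simp)
    have haF : a ∈ G.F {a} 1 := hsub (by simp)
    have hca := G.base.coeff_simple ha
    obtain ⟨c, hcΔ, hca', hac⟩ : ∃ c ∈ G.base.Δ0, c ≠ a ∧ ⟪a, c⟫ ≠ 0 := by
      by_contra! hcon
      have h0 : {a} = G.base.Δ0 := hirr' {a} hSg (by simp) (by
        intro x hx y hy hyx
        rw [Finset.mem_singleton] at hx hyx
        rw [hx]; exact hcon y hy hyx)
      have : G.F {a} 1 ⊆ {a} := by
        intro β hβ
        rw [mem_F] at hβ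
        rw [Finset.mem_singleton]
        refine G.base.ext_coeff hβ.1 (G.base.base_sub ha) fun α hα => ?_
        rw [← h0, Finset.mem_singleton] at hα
        subst hα
        rw [hca α ha, if_pos rfl]
        simpa [RootSystemBase.ht] using hβ.2
      have := Finset.card_le_card this
      simp [h1] at this
    obtain ⟨k, hk0, hrF, hrc⟩ := refl_F hSg haF hcΔ (by simpa using hca') hac
    set r := a - (k : ℝ) • c with hr
    have hrcc : G.base.coeff r c ≠ 0 := by
      rw [hrc c hcΔ, hca c hcΔ]; simp [hca', hk0]
    have har : a ≠ r := by
      intro h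
      apply hrcc
      rw [← h, hca c hcΔ, if_neg hca']
    have hda : ∀ d ∈ G.base.Δ0, d ≠ a → d ≠ c → ⟪a, d⟫ = 0 := by
      intro d hd hda hdc
      by_contra h
      obtain ⟨k', hk0', hF', hc'⟩ := refl_F hSg haF hd (by simpa using hda) h
      have hd1 := hc' d hd
      have hd2 := hc' c hcΔ
      rw [hca d hd, if_neg hda, if_pos rfl] at hd1
      rw [hca c hcΔ, if_neg hca', if_neg hdc.symm] at hd2
      refine no_third h1 haF hrF hF' har ?_ ?_
      · intro he
        rw [← he, hca d hd, if_neg hda] at hd1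
        omega
      · intro he
        rw [← he] at hd2
        exact hrcc (by omega)
    have hdc : ∀ d ∈ G.base.Δ0, d ≠ a → d ≠ c → ⟪c, d⟫ = 0 := by
      intro d hd hda' hdc
      by_contra h
      have hrd : ⟪r, d⟫ ≠ 0 := by
        rw [hr, inner_sub_left, real_inner_smul_left, hda d hd hda' hdc]
        simp [hk0, h]
      obtain ⟨k', hk0', hF', hc'⟩ := refl_F hSg hrF hd (by simpa using hda') hrd
      have hd1 := hc' d hd
      have hd2 := hc' c hcΔ
      have hd3 := hrc d hd
      rw [hca d hd, if_neg hda', if_neg hdc] at hd3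
      rw [if_pos rfl] at hd1
      rw [if_neg hdc.symm] at hd2
      refine no_third h1 haF hrF hF' har ?_ ?_
      · intro he
        rw [← he, hca c hcΔ, if_neg hca'] at hd2
        exact hrcc (by omega)
      · intro he
        rw [← he] at hd1
        omega
    refine ⟨a, c, hca'.symm, ?_, hac, Or.inl rfl⟩
    symm
    refine hirr' {a, c} ?_ (by simp) ?_
    · intro x hx
      simp only [Finset.mem_insert, Finset.mem_singleton] at hx
      rcases hx with rfl | rfl <;> assumption
    · intro x hx y hy hyx
      simp only [Finset.mem_insert, Finset.mem_singleton, not_or] at hx hyx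
      rcases hx with rfl | rfl
      · exact hda y hy hyx.1 hyx.2
      · exact hdc y hy hyx.1 hyx.2
  · obtain ⟨a, b, hab, rfl⟩ := Finset.card_eq_two.1 hc
    have h0 : {a, b} = G.base.Δ0 := by
      refine hirr' _ hSg hne ?_
      intro x hx d hd hdS
      by_contra h
      obtain ⟨k', hk0', hF', hc'⟩ := refl_F hSg (hsub hx) hd hdS h
      have hd1 := hc' d hd
      have hz : ∀ y ∈ ({a, b} : Finset V), G.base.coeff y d = 0 := by
        intro y hy
        rw [G.base.coeff_simple (hSg hy) d hd, if_neg]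
        rintro rfl; exact hdS hy
      rw [hz x hx, if_pos rfl] at hd1
      refine no_third h1 (hsub (show a ∈ _ by simp)) (hsub (show b ∈ _ by simp)) hF' hab ?_ ?_
      · intro he
        rw [← he, hz a (by simp)] at hd1
        omega
      · intro he
        rw [← he, hz b (by simp)] at hd1
        omega
    refine ⟨a, b, hab, h0.symm, ?_, Or.inr rfl⟩
    intro hz
    have := hirr' {a} (by rw [← h0]; simp) (by simp) (by
      intro x hx y hy hyx
      rw [Finset.mem_singleton] at hx hyx
      rw [← h0] at hy
      simp only [Finset.mem_insert, Finset.mem_singleton] at hy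
      rcases hy with rfl | rfl
      · exact absurd rfl hyx
      · rw [hx]; exact hz)
    rw [← h0] at this
    have hb : b ∈ ({a} : Finset V) := by rw [this]; simp
    exact hab (Finset.mem_singleton.1 hb).symm

end GradedLieData

/-- Let `𝔤` be a complex simple Lie algebra with a grading of Monge
type determined by a nonempty subset `Σ` of the simple roots, and suppose
`dim 𝔤₋₁ = 2`.  Then `(𝔤, Σ)` is one of exactly the following five:
`A₂{α₁,α₂}`, `B₂{α₂}`, `B₂{α₁,α₂}`, `G₂{α₁}`, `G₂{α₁,α₂}`; and conversely each of
these five gradings is of Monge type with `dim 𝔤₋₁ = 2`.  (Here `a` denotes `α₁` and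
`b` denotes `α₂`; the rank-two types are recognized by their Cartan integers, with
`α₂` the short root of `B₂` and `α₁` the short root of `G₂`.) -/
theorem statement1 {V : Type*} [NormedAddCommGroup V] [InnerProductSpace ℝ V]
    {L : Type*} [LieRing L] [LieAlgebra ℂ L] [FiniteDimensional ℂ L]
    (hsimp : LieAlgebra.IsSimple ℂ L)
    (G : GradedLieData V L) (Sg : Finset V) (hSg : Sg ⊆ G.base.Δ0) (hne : Sg.Nonempty) :
    (G.Monge Sg ∧ Module.finrank ℂ ↥(G.g Sg (-1)) = 2) ↔
      ∃ a b : V, a ≠ b ∧ G.base.Δ0 = {a, b} ∧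
        ((RootSystemBase.cInt a b = -1 ∧ RootSystemBase.cInt b a = -1 ∧
            Sg = {a, b}) ∨
         (RootSystemBase.cInt a b = -2 ∧ RootSystemBase.cInt b a = -1 ∧
            (Sg = {b} ∨ Sg = {a, b})) ∨
         (RootSystemBase.cInt a b = -1 ∧ RootSystemBase.cInt b a = -3 ∧
            (Sg = {a} ∨ Sg = {a, b}))) := by
  rw [GradedLieData.monge_iff G hSg hne]
  constructor
  · rintro ⟨h1, h2⟩
    obtain ⟨a, b, hab, h0, hne0, hS⟩ := GradedLieData.forward (G.irred hsimp) hSg hne h1 h2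
    have h0' : G.base.Δ0 = {b, a} := by rw [h0, Finset.pair_comm]
    have hcp := G.base.cartan_pairs (a := a) (b := b) (by simp [h0]) (by simp [h0]) hab hne0
    rcases hS with rfl | rfl
    · rcases hcp with ⟨hk, hl⟩ | ⟨hk, hl⟩ | ⟨hk, hl⟩ | ⟨hk, hl⟩ | ⟨hk, hl⟩
      · exact (GradedLieData.single_A2 hab h0 hk hl h2).elim
      · exact ⟨b, a, hab.symm, h0', Or.inr (Or.inl ⟨hl, hk, Or.inl rfl⟩)⟩
      · exact ⟨a, b, hab, h0, Or.inr (Or.inr ⟨hk, hl, Or.inl rfl⟩)⟩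
      · exact (GradedLieData.single_k hab h0 (Or.inl hk) hl h1).elim
      · exact (GradedLieData.single_k hab h0 (Or.inr hk) hl h1).elim
    · rcases hcp with ⟨hk, hl⟩ | ⟨hk, hl⟩ | ⟨hk, hl⟩ | ⟨hk, hl⟩ | ⟨hk, hl⟩
      · exact ⟨a, b, hab, h0, Or.inl ⟨hk, hl, rfl⟩⟩
      · exact ⟨b, a, hab.symm, h0', Or.inr (Or.inl ⟨hl, hk, Or.inr (Finset.pair_comm a b)⟩)⟩
      · exact ⟨a, b, hab, h0, Or.inr (Or.inr ⟨hk, hl, Or.inr rfl⟩)⟩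
      · exact ⟨a, b, hab, h0, Or.inr (Or.inl ⟨hk, hl, Or.inr rfl⟩)⟩
      · exact ⟨b, a, hab.symm, h0', Or.inr (Or.inr ⟨hl, hk, Or.inr (Finset.pair_comm a b)⟩)⟩
  · rintro ⟨a, b, hab, h0, h⟩
    have h0' : G.base.Δ0 = {b, a} := by rw [h0, Finset.pair_comm]
    rcases h with ⟨hk, hl, rfl⟩ | ⟨hk, hl, rfl | rfl⟩ | ⟨hk, hl, rfl | rfl⟩
    · exact GradedLieData.pair_card hab h0 hk
    · exact GradedLieData.single_card hab.symm h0' hl (Or.inl hk)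
    · rw [Finset.pair_comm]
      exact GradedLieData.pair_card hab.symm h0' hl
    · exact GradedLieData.single_card hab h0 hk (Or.inr hl)
    · exact GradedLieData.pair_card hab h0 hk
end

section
/- Let 𝔤 be a complex semisimple Lie algebra whose grading determined by a nonempty subset Σ of the simple roots is of Monge type, with dim 𝔤₋₁ > 2. If 𝔤₀ contains no simple ideal of 𝔤, then 𝔤 is simple. -/
open scoped RealInnerProductSpace BigOperators Classical

namespace RootSystemBase

variable {V : Type*} [NormedAddCommGroup V] [InnerProductSpace ℝ V]

theorem coeff_unique_s5 (R : RootSystemBase V) {β : V} (hβ : β ∈ R.Δ) (c : V → ℤ)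
    (h : β = ∑ α ∈ R.Δ0, (c α : ℝ) • α) : ∀ α ∈ R.Δ0, R.coeff β α = c α := by
  intro α hα
  have h1 : ∑ α ∈ R.Δ0, ((R.coeff β α : ℝ) - (c α : ℝ)) • α = 0 := by
    simp only [sub_smul, Finset.sum_sub_distrib]
    rw [← R.coeff_spec β hβ, ← h, sub_self]
  have h2 := (linearIndependent_iff'.mp R.indep) Finset.univ
    (fun a => (R.coeff β a : ℝ) - (c a : ℝ)) (by
      rw [← h1]
      exact Finset.sum_coe_sort R.Δ0 (fun a => ((R.coeff β a : ℝ) - (c a : ℝ)) • a))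
    ⟨α, hα⟩ (Finset.mem_univ _)
  have h3 : (R.coeff β α : ℝ) = c α := by simpa [sub_eq_zero] using h2
  exact_mod_cast h3

theorem ht_neg (R : RootSystemBase V) {S : Finset V} (hS : S ⊆ R.Δ0) {β : V} (hβ : β ∈ R.Δ) :
    R.ht S (-β) = - R.ht S β := by
  have h := R.coeff_unique_s5 (R.neg_mem β hβ) (fun α => - R.coeff β α) (by
    conv_lhs => rw [R.coeff_spec β hβ]
    simp [Finset.sum_neg_distrib])
  unfold ht
  rw [← Finset.sum_neg_distrib]
  exact Finset.sum_congr rfl (fun α hα => h α (hS hα))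

theorem ht_add (R : RootSystemBase V) {S : Finset V} (hS : S ⊆ R.Δ0) {β γ : V} (hβ : β ∈ R.Δ)
    (hγ : γ ∈ R.Δ) (hs : β + γ ∈ R.Δ) :
    R.ht S (β + γ) = R.ht S β + R.ht S γ := by
  have h := R.coeff_unique_s5 hs (fun α => R.coeff β α + R.coeff γ α) (by
    conv_lhs => rw [R.coeff_spec β hβ, R.coeff_spec γ hγ]
    simp [add_smul, Finset.sum_add_distrib])
  unfold ht
  rw [← Finset.sum_add_distrib]
  exact Finset.sum_congr rfl (fun α hα => h α (hS hα))

theorem ht_simple (R : RootSystemBase V) {S : Finset V} (hS : S ⊆ R.Δ0) {α : V} (hα : α ∈ R.Δ0) :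
    R.ht S α = if α ∈ S then 1 else 0 := by
  have h := R.coeff_unique_s5 (R.base_sub hα) (fun γ => if γ = α then 1 else 0) (by
    simp [hα])
  unfold ht
  rw [Finset.sum_congr rfl (fun γ hγ => h γ (hS hγ))]
  simp

theorem coeff_nonneg_of_ht_pos (R : RootSystemBase V) {S : Finset V} (hS : S ⊆ R.Δ0) {β : V}
    (hβ : β ∈ R.Δ) (h : 0 < R.ht S β) : ∀ α ∈ R.Δ0, 0 ≤ R.coeff β α := by
  rcases R.coeff_sign β hβ with h1 | h1
  · exact h1
  · exfalso
    have : R.ht S β ≤ 0 := Finset.sum_nonpos (fun α hα => h1 α (hS hα))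
    omega

theorem ht_base_nonneg (R : RootSystemBase V) {S : Finset V} (hS : S ⊆ R.Δ0) {β : V}
    (hβ : β ∈ R.Δ) (h : 0 < R.ht S β) : 0 ≤ R.ht R.Δ0 β :=
  Finset.sum_nonneg (R.coeff_nonneg_of_ht_pos hS hβ h)

theorem sub_mem (R : RootSystemBase V) {α β : V} (hα : α ∈ R.Δ) (hβ : β ∈ R.Δ)
    (hpos : 0 < ⟪β, α⟫) : β = α ∨ β - α ∈ R.Δ := by
  obtain ⟨k, hk⟩ := R.crystal α hα β hβ
  obtain ⟨m, hm⟩ := R.crystal β hβ α hα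
  have ha : 0 < ⟪α, α⟫ := real_inner_self_pos.mpr (R.ne_zero α hα)
  have hb : 0 < ⟪β, β⟫ := real_inner_self_pos.mpr (R.ne_zero β hβ)
  have hr1 := R.reflect_mem α hα β hβ
  have hr2 := R.reflect_mem β hβ α hα
  rw [hk] at hr1
  rw [hm] at hr2
  rw [real_inner_comm] at hm
  have hcs := real_inner_mul_inner_self_le β α
  have hk' : 2 * ⟪β, α⟫ = k * ⟪α, α⟫ := by field_simp at hk; linarith
  have hm' : 2 * ⟪β, α⟫ = m * ⟪β, β⟫ := by field_simp at hm; linarith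
  have hk0 : 0 < k := by
    have : (0:ℝ) < k := by rw [← hk]; positivity
    exact_mod_cast this
  have hm0 : 0 < m := by
    have : (0:ℝ) < m := by rw [← hm]; positivity
    exact_mod_cast this
  have hkm : k * m ≤ 4 := by
    have h1 : ((k * m : ℤ) : ℝ) * (⟪α, α⟫ * ⟪β, β⟫) ≤ 4 * (⟪α, α⟫ * ⟪β, β⟫) := by
      push_cast
      have : (k:ℝ) * m * (⟪α, α⟫ * ⟪β, β⟫) = (2 * ⟪β, α⟫) * (2 * ⟪β, α⟫) := by
        nth_rewrite 1 [hk']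
        rw [hm']; ring
      rw [this]; nlinarith
    have := le_of_mul_le_mul_right h1 (mul_pos ha hb)
    exact_mod_cast this
  by_cases hk1 : k = 1
  · right; simpa [hk1] using hr1
  by_cases hm1 : m = 1
  · right
    have := R.neg_mem _ hr2
    simpa [hm1] using this
  have hk2 : k = 2 := by nlinarith [show 2 ≤ k by omega, show 2 ≤ m by omega]
  have hm2 : m = 2 := by subst hk2; omega
  left
  subst hk2 hm2
  push_cast at hk' hm'
  have : ⟪β - α, β - α⟫ = 0 := by
    rw [real_inner_sub_sub_self]; linarith
  exact sub_eq_zero.mp (inner_self_eq_zero.mp this)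

theorem exists_simple (R : RootSystemBase V) {β : V} (hβ : β ∈ R.Δ)
    (h : ∀ α ∈ R.Δ0, 0 ≤ R.coeff β α) : ∃ α ∈ R.Δ0, β = α ∨ β - α ∈ R.Δ := by
  have hb : 0 < ⟪β, β⟫ := real_inner_self_pos.mpr (R.ne_zero β hβ)
  have h2 : ⟪β, β⟫ = ∑ α ∈ R.Δ0, (R.coeff β α : ℝ) * ⟪β, α⟫ := by
    conv_lhs => rhs; rw [R.coeff_spec β hβ]
    rw [inner_sum]
    simp [real_inner_smul_right]
  rw [h2] at hb
  obtain ⟨α, hα, hp⟩ := Finset.exists_lt_of_sum_lt (s := R.Δ0) (f := fun _ => (0:ℝ)) (by simpa using hb)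
  refine ⟨α, hα, R.sub_mem (R.base_sub hα) hβ ?_⟩
  have : (0:ℝ) ≤ R.coeff β α := by exact_mod_cast h α hα
  exact pos_of_mul_pos_right hp this

end RootSystemBase

namespace GradedLieData

variable {V : Type*} [NormedAddCommGroup V] [InnerProductSpace ℝ V]
variable {L : Type*} [LieRing L] [LieAlgebra ℂ L]

theorem rs_exists (G : GradedLieData V L) {β : V} (hβ : β ∈ G.base.Δ) :
    ∃ e ∈ G.rs β, e ≠ 0 ∧ ∀ x ∈ G.rs β, ∃ c : ℂ, x = c • e := by
  obtain ⟨v, hv, h⟩ := finrank_eq_one_iff'.mp (G.rs_dim β hβ)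
  refine ⟨v, v.2, by simpa using hv, fun x hx => ?_⟩
  obtain ⟨c, hc⟩ := h ⟨x, hx⟩
  exact ⟨c, by simpa using (congrArg Subtype.val hc).symm⟩

theorem rs_le_of_add (G : GradedLieData V L) {β γ : V} (hβ : β ∈ G.base.Δ) (hγ : γ ∈ G.base.Δ)
    (hs : β + γ ∈ G.base.Δ) (K : Submodule ℂ L)
    (hK : ∀ x ∈ G.rs β, ∀ y ∈ G.rs γ, ⁅x, y⁆ ∈ K) : G.rs (β + γ) ≤ K := by
  obtain ⟨e, he, he0, -⟩ := G.rs_exists hβ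
  obtain ⟨f, hf, hf0, -⟩ := G.rs_exists hγ
  obtain ⟨u, hu, hu0, hall⟩ := G.rs_exists hs
  have h1 := G.br_rs_mem β hβ γ hγ hs e he f hf
  have h2 : ⁅e, f⁆ ≠ 0 := fun h => by
    rcases G.br_nondeg β hβ γ hγ hs e he f hf h with h | h <;> contradiction
  obtain ⟨c, hc⟩ := hall _ h1
  have hc0 : c ≠ 0 := by rintro rfl; simp at hc; exact h2 hc
  intro x hx
  obtain ⟨d, rfl⟩ := hall x hx
  have : u = c⁻¹ • ⁅e, f⁆ := by rw [hc, smul_smul, inv_mul_cancel₀ hc0, one_smul]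
  rw [this]
  exact K.smul_mem _ (K.smul_mem _ (hK e he f hf))

theorem decomp (G : GradedLieData V L) (a : L) :
    ∃ h ∈ G.H, ∃ f : V → L, (∀ γ ∈ G.base.Δ, f γ ∈ G.rs γ) ∧ a = h + ∑ γ ∈ G.base.Δ, f γ := by
  have ha : a ∈ G.H ⊔ (⨆ β ∈ G.base.Δ, G.rs β) := by rw [G.sup_eq_top]; trivial
  obtain ⟨h, hh, r, hr, rfl⟩ := Submodule.mem_sup.mp ha
  obtain ⟨μ, hμ⟩ := (Submodule.mem_iSup_finset_iff_exists_sum _ _).mp hr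
  exact ⟨h, hh, fun γ => μ γ, fun γ _ => (μ γ).2, by rw [hμ]⟩

theorem decomp_zero (G : GradedLieData V L) {h : L} (hh : h ∈ G.H) {f : V → L}
    (hf : ∀ γ ∈ G.base.Δ, f γ ∈ G.rs γ) (h0 : h + ∑ γ ∈ G.base.Δ, f γ = 0) :
    h = 0 ∧ ∀ γ ∈ G.base.Δ, f γ = 0 := by
  have key : ∀ γ ∈ G.base.Δ, f γ = 0 := by
    intro γ hγ
    refine Submodule.disjoint_def.mp (G.rs_indep γ hγ) _ (hf γ hγ) ?_
    rw [← Finset.add_sum_erase _ _ hγ] at h0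
    have : f γ = -(h + ∑ x ∈ G.base.Δ.erase γ, f x) := by
      rw [eq_neg_iff_add_eq_zero, ← h0]; abel
    rw [this]
    refine Submodule.neg_mem _ (Submodule.add_mem_sup hh (Submodule.sum_mem _ fun x hx => ?_))
    exact (le_iSup₂_of_le (f := fun γ (_ : γ ∈ G.base.Δ.erase _) => G.rs γ) x hx le_rfl)
      (hf x (Finset.mem_of_mem_erase hx))
  refine ⟨?_, key⟩
  rwa [Finset.sum_eq_zero key, add_zero] at h0

theorem weight (G : GradedLieData V L) (w : V) {h : L} (hh : h ∈ G.H) {f : V → L}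
    (hf : ∀ γ ∈ G.base.Δ, f γ ∈ G.rs γ)
    (hw : ∀ v, ⁅G.toH v, h + ∑ γ ∈ G.base.Δ, f γ⁆ =
      ((⟪w, v⟫ : ℝ) : ℂ) • (h + ∑ γ ∈ G.base.Δ, f γ)) :
    (w ≠ 0 → h = 0) ∧ ∀ γ ∈ G.base.Δ, γ ≠ w → f γ = 0 := by
  have key : ∀ v, ((⟪w, v⟫ : ℝ) : ℂ) • h = 0 ∧
      ∀ γ ∈ G.base.Δ, (((⟪w, v⟫ : ℝ) : ℂ) - ((⟪γ, v⟫ : ℝ) : ℂ)) • f γ = 0 := by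
    intro v
    refine G.decomp_zero (G.H.smul_mem _ hh) (f := fun γ => _ • f γ)
      (fun γ hγ => (G.rs γ).smul_mem _ (hf γ hγ)) ?_
    have h1 := hw v
    rw [lie_add, G.br_h_h _ (G.toH_mem v) _ hh, zero_add, lie_sum,
      Finset.sum_congr rfl (fun γ hγ => G.br_toH v γ hγ _ (hf γ hγ)), smul_add,
      Finset.smul_sum] at h1
    simp only [sub_smul, Finset.sum_sub_distrib]
    rw [h1]; abel
  constructor
  · intro hw0
    rcases smul_eq_zero.mp (key w).1 with h | h
    · exact absurd (by exact_mod_cast h) (inner_self_ne_zero (𝕜 := ℝ).mpr hw0)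
    · exact h
  · intro γ hγ hne
    rcases smul_eq_zero.mp ((key (w - γ)).2 γ hγ) with h | h
    · exfalso
      have h' : ⟪w, w - γ⟫ - ⟪γ, w - γ⟫ = 0 := by exact_mod_cast h
      rw [← inner_sub_left] at h'
      exact hne (sub_eq_zero.mp (inner_self_eq_zero.mp h')).symm
    · exact h

theorem weight_zero (G : GradedLieData V L) {a : L} (ha : ∀ v, ⁅G.toH v, a⁆ = 0) : a ∈ G.H := by
  obtain ⟨h, hh, f, hf, rfl⟩ := G.decomp a
  have := (G.weight 0 hh hf (by simpa using ha)).2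
  rw [Finset.sum_eq_zero (fun γ hγ => this γ hγ (G.base.ne_zero γ hγ)), add_zero]
  exact hh

theorem weight_root (G : GradedLieData V L) {β : V} (hβ : β ∈ G.base.Δ) {a : L}
    (ha : ∀ v, ⁅G.toH v, a⁆ = ((⟪β, v⟫ : ℝ) : ℂ) • a) : a ∈ G.rs β := by
  obtain ⟨h, hh, f, hf, rfl⟩ := G.decomp a
  have := G.weight β hh hf ha
  rw [this.1 (G.base.ne_zero β hβ), zero_add,
    Finset.sum_eq_single_of_mem β hβ (fun γ hγ hne => this.2 γ hγ hne)]
  exact hf β hβ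

/-- elements of `H` act on opposite root spaces by opposite scalars -/
theorem opp_scalar (G : GradedLieData V L) {β : V} (hβ : β ∈ G.base.Δ) {h : L} (hh : h ∈ G.H) :
    ∃ s : ℂ, (∀ x ∈ G.rs β, ⁅h, x⁆ = s • x) ∧ ∀ y ∈ G.rs (-β), ⁅h, y⁆ = -(s • y) := by
  rw [G.H_span] at hh
  induction hh using Submodule.span_induction with
  | mem z hz =>
    obtain ⟨v, -, rfl⟩ := hz
    refine ⟨((⟪β, v⟫ : ℝ) : ℂ), fun x hx => G.br_toH v β hβ x hx, fun y hy => ?_⟩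
    rw [G.br_toH v _ (G.base.neg_mem β hβ) y hy]
    simp
  | zero => exact ⟨0, by simp, by simp⟩
  | add a b _ _ iha ihb =>
    obtain ⟨s, h1, h2⟩ := iha
    obtain ⟨t, h3, h4⟩ := ihb
    refine ⟨s + t, fun x hx => ?_, fun y hy => ?_⟩
    · rw [add_lie, h1 x hx, h3 x hx, add_smul]
    · rw [add_lie, h2 y hy, h4 y hy, add_smul]; abel
  | smul c a _ iha =>
    obtain ⟨s, h1, h2⟩ := iha
    refine ⟨c * s, fun x hx => ?_, fun y hy => ?_⟩
    · rw [smul_lie, h1 x hx, smul_smul]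
    · rw [smul_lie, h2 y hy, smul_neg, smul_smul]

theorem split_aux (I J : LieIdeal ℂ L) (hd : ∀ x, x ∈ I → x ∈ J → x = 0) {t a b : L} {c : ℂ}
    (ha : a ∈ I) (hb : b ∈ J) (h : ⁅t, a + b⁆ = c • (a + b)) :
    ⁅t, a⁆ = c • a ∧ ⁅t, b⁆ = c • b := by
  have e : ⁅t, a⁆ - c • a = -(⁅t, b⁆ - c • b) := by
    rw [lie_add, smul_add] at h
    rw [eq_neg_iff_add_eq_zero]
    rw [← sub_eq_zero] at h
    rw [← h]; abel
  have m1 : ⁅t, a⁆ - c • a ∈ I := I.sub_mem (I.lie_mem ha) (I.smul_mem c ha)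
  have m2 : ⁅t, b⁆ - c • b ∈ J := J.sub_mem (J.lie_mem hb) (J.smul_mem c hb)
  have z := hd _ m1 (by rw [e]; exact J.neg_mem m2)
  refine ⟨sub_eq_zero.mp z, sub_eq_zero.mp ?_⟩
  rw [z] at e
  exact neg_eq_zero.mp e.symm

theorem rs_le_or (G : GradedLieData V L) (I J : LieIdeal ℂ L)
    (hd : ∀ x, x ∈ I → x ∈ J → x = 0) (hs : ∀ x : L, ∃ a ∈ I, ∃ b ∈ J, a + b = x)
    {β : V} (hβ : β ∈ G.base.Δ) : (∀ x ∈ G.rs β, x ∈ I) ∨ (∀ x ∈ G.rs β, x ∈ J) := by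
  obtain ⟨e, he, he0, hall⟩ := G.rs_exists hβ
  obtain ⟨a, ha, b, hb, rfl⟩ := hs e
  have h := fun v => split_aux I J hd ha hb (G.br_toH v β hβ _ he)
  have ha' := G.weight_root hβ (fun v => (h v).1)
  have hb' := G.weight_root hβ (fun v => (h v).2)
  by_cases hz : a = 0
  · right
    intro x hx
    obtain ⟨c, rfl⟩ := hall x hx
    rw [hz, zero_add]; exact J.smul_mem c hb
  · left
    obtain ⟨c, hc⟩ := hall a ha'
    have hc0 : c ≠ 0 := by rintro rfl; simp at hc; exact hz hc
    intro x hx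
    obtain ⟨d, rfl⟩ := hall x hx
    have : a + b = c⁻¹ • a := by
      conv_rhs => rw [hc]
      rw [smul_smul, inv_mul_cancel₀ hc0, one_smul]
    rw [this]; exact I.smul_mem _ (I.smul_mem _ ha)

theorem H_split (G : GradedLieData V L) (I J : LieIdeal ℂ L)
    (hd : ∀ x, x ∈ I → x ∈ J → x = 0) (hs : ∀ x : L, ∃ a ∈ I, ∃ b ∈ J, a + b = x)
    {h : L} (hh : h ∈ G.H) : ∃ a ∈ I, ∃ b ∈ J, a ∈ G.H ∧ b ∈ G.H ∧ a + b = h := by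
  obtain ⟨a, ha, b, hb, rfl⟩ := hs h
  have hw := fun v => split_aux I J hd ha hb (c := 0) (t := G.toH v)
    (by rw [zero_smul]; exact G.br_h_h _ (G.toH_mem v) _ hh)
  exact ⟨a, ha, b, hb, G.weight_zero (fun v => by simpa using (hw v).1),
    G.weight_zero (fun v => by simpa using (hw v).2), rfl⟩

theorem rs_neg (G : GradedLieData V L) (I J : LieIdeal ℂ L)
    (hd : ∀ x, x ∈ I → x ∈ J → x = 0) (hs : ∀ x : L, ∃ a ∈ I, ∃ b ∈ J, a + b = x)
    {β : V} (hβ : β ∈ G.base.Δ) (hJ : ∀ x ∈ G.rs β, x ∈ J) : ∀ x ∈ G.rs (-β), x ∈ J := by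
  rcases G.rs_le_or I J hd hs (G.base.neg_mem β hβ) with h | h
  swap
  · exact h
  exfalso
  obtain ⟨e, he, he0, -⟩ := G.rs_exists hβ
  obtain ⟨f, hf, hf0, -⟩ := G.rs_exists (G.base.neg_mem β hβ)
  obtain ⟨a, ha, b, hb, haH, hbH, hab⟩ := G.H_split I J hd hs (G.toH_mem β)
  have hIJ : ∀ x ∈ I, ∀ y ∈ J, ⁅x, y⁆ = 0 := fun x hx y hy =>
    hd _ (lie_mem_left ℂ L I x y hx) (J.lie_mem hy)
  have hae : ⁅a, e⁆ = 0 := hIJ a ha e (hJ e he)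
  have hbf : ⁅b, f⁆ = 0 := by rw [← lie_skew, hIJ f (h f hf) b hb, neg_zero]
  obtain ⟨s, hs1, hs2⟩ := G.opp_scalar hβ hbH
  have s0 : s = 0 := by
    have := hs2 f hf
    rw [hbf, eq_comm, neg_eq_zero] at this
    exact (smul_eq_zero.mp this).resolve_right hf0
  have h2 := G.br_toH β β hβ e he
  rw [← hab, add_lie, hae, hs1 e he, s0, zero_smul, add_zero, eq_comm] at h2
  rcases smul_eq_zero.mp h2 with h3 | h3
  · exact inner_self_ne_zero (𝕜 := ℝ).mpr (G.base.ne_zero β hβ) (by exact_mod_cast h3)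
  · exact he0 h3

theorem rs_le_g (G : GradedLieData V L) (Sg : Finset V) {β : V} (hβ : β ∈ G.base.Δ) :
    G.rs β ≤ G.g Sg (G.base.ht Sg β) := by
  have : G.rs β ≤ ⨆ γ ∈ G.base.Δ.filter (fun γ => G.base.ht Sg γ = G.base.ht Sg β), G.rs γ :=
    le_iSup₂_of_le (f := fun γ (_ : γ ∈ G.base.Δ.filter (fun γ => G.base.ht Sg γ = G.base.ht Sg β))
      => G.rs γ) β (by simp [hβ]) le_rfl
  unfold g
  split_ifs with h
  · simp only [h] at this
    exact this.trans le_sup_right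
  · exact this

theorem g_le (G : GradedLieData V L) (Sg : Finset V) {j : ℤ} (hj : j ≠ 0) (K : Submodule ℂ L)
    (h : ∀ β ∈ G.base.Δ, G.base.ht Sg β = j → G.rs β ≤ K) : G.g Sg j ≤ K := by
  unfold g
  rw [if_neg hj]
  refine iSup₂_le fun β hβ => ?_
  rw [Finset.mem_filter] at hβ
  exact h β hβ.1 hβ.2

/-- If all root spaces of height `-1` are in `J` then so are all of nonzero height. -/
theorem rs_le_of_ht (G : GradedLieData V L) {Sg : Finset V} (hSg : Sg ⊆ G.base.Δ0)
    (I J : LieIdeal ℂ L)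
    (hd : ∀ x, x ∈ I → x ∈ J → x = 0) (hs : ∀ x : L, ∃ a ∈ I, ∃ b ∈ J, a + b = x)
    (h1 : ∀ β ∈ G.base.Δ, G.base.ht Sg β = -1 → ∀ x ∈ G.rs β, x ∈ J) :
    ∀ β ∈ G.base.Δ, G.base.ht Sg β ≠ 0 → ∀ x ∈ G.rs β, x ∈ J := by
  have hone : ∀ β ∈ G.base.Δ, G.base.ht Sg β = 1 → ∀ x ∈ G.rs β, x ∈ J := by
    intro β hβ h
    have hn := G.base.neg_mem β hβ
    have := G.rs_neg I J hd hs hn (h1 _ hn (by rw [G.base.ht_neg hSg hβ, h]))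
    rwa [neg_neg] at this
  have hpos : ∀ n : ℕ, ∀ β ∈ G.base.Δ, 0 < G.base.ht Sg β → G.base.ht G.base.Δ0 β < n →
      ∀ x ∈ G.rs β, x ∈ J := by
    intro n
    induction n with
    | zero =>
      intro β hβ hp hn
      have := G.base.ht_base_nonneg hSg hβ hp
      simp at hn; omega
    | succ n ih =>
      intro β hβ hp hn
      obtain ⟨α, hα, h | h⟩ := G.base.exists_simple hβ (G.base.coeff_nonneg_of_ht_pos hSg hβ hp)
      · subst h
        refine hone β hβ ?_
        rw [G.base.ht_simple hSg hα] at hp ⊢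
        split_ifs at hp ⊢ <;> simp_all
      · have hαΔ := G.base.base_sub hα
        have e : α + (β - α) = β := by abel
        have hβ' : α + (β - α) ∈ G.base.Δ := by rwa [e]
        have e1 := G.base.ht_add hSg hαΔ h hβ'
        have e2 := G.base.ht_add (le_refl _) hαΔ h hβ'
        rw [e, G.base.ht_simple hSg hα] at e1
        rw [e, G.base.ht_simple (le_refl _) hα, if_pos hα] at e2
        have := G.rs_le_of_add hαΔ h hβ' (J : Submodule ℂ L) (by
          intro x hx y hy
          by_cases hc : 0 < G.base.ht Sg (β - α)
          · exact J.lie_mem (ih _ h hc (by push_cast at hn; omega) y hy)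
          · have hαS : α ∈ Sg := by by_contra hcon; rw [if_neg hcon] at e1; omega
            exact lie_mem_left ℂ L J x y
              (hone α hαΔ (by rw [G.base.ht_simple hSg hα, if_pos hαS]) x hx))
        rw [e] at this
        exact this
  intro β hβ hne
  rcases lt_or_gt_of_ne hne with h | h
  · have hn := G.base.neg_mem β hβ
    have := G.rs_neg I J hd hs hn (hpos ((G.base.ht G.base.Δ0 (-β)).toNat + 1) _ hn
      (by rw [G.base.ht_neg hSg hβ]; omega) (by push_cast; omega))
    rwa [neg_neg] at this
  · exact hpos ((G.base.ht G.base.Δ0 β).toNat + 1) _ hβ h (by push_cast; omega)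

theorem le_g_zero (G : GradedLieData V L) {Sg : Finset V} (hSg : Sg ⊆ G.base.Δ0)
    (I J : LieIdeal ℂ L)
    (hd : ∀ x, x ∈ I → x ∈ J → x = 0) (hs : ∀ x : L, ∃ a ∈ I, ∃ b ∈ J, a + b = x)
    (h1 : ∀ β ∈ G.base.Δ, G.base.ht Sg β = -1 → ∀ x ∈ G.rs β, x ∈ J) :
    (I : Submodule ℂ L) ≤ G.g Sg 0 := by
  have hJ := G.rs_le_of_ht hSg I J hd hs h1
  have top : (⊤ : Submodule ℂ L) ≤ ((I : Submodule ℂ L) ⊓ G.g Sg 0) ⊔ (J : Submodule ℂ L) := by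
    rw [← G.sup_eq_top]
    refine sup_le ?_ (iSup₂_le fun β hβ => ?_)
    · intro h hh
      obtain ⟨a, ha, b, hb, haH, hbH, rfl⟩ := G.H_split I J hd hs hh
      refine Submodule.add_mem_sup ⟨ha, ?_⟩ hb
      unfold g
      rw [if_pos rfl]
      exact (le_sup_left : G.H ≤ _) haH
    · by_cases hc : G.base.ht Sg β = 0
      · rcases G.rs_le_or I J hd hs hβ with h | h
        · refine le_trans (le_inf h ?_) le_sup_left
          rw [← hc]; exact G.rs_le_g Sg hβ
        · exact le_trans h le_sup_right
      · exact le_trans (hJ β hβ hc) le_sup_right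
  intro a ha
  obtain ⟨p, hp, q, hq, hpq⟩ := Submodule.mem_sup.mp (top (Submodule.mem_top (x := a)))
  have : q = 0 := by
    refine hd q ?_ hq
    have : q = a - p := by rw [← hpq]; abel
    rw [this]; exact I.sub_mem ha hp.1
  rw [← hpq, this, add_zero]
  exact hp.2

/-- `𝔤₋₂ ⊆ [𝔤₋₁, 𝔤₋₁]` -/
theorem g_two_le (G : GradedLieData V L) {Sg : Finset V} (hSg : Sg ⊆ G.base.Δ0)
    (D : Submodule ℂ L)
    (hD : D = Submodule.span ℂ {z | ∃ a ∈ G.g Sg (-1), ∃ b ∈ G.g Sg (-1), ⁅a, b⁆ = z}) :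
    G.g Sg (-2) ≤ D := by
  have hD1 : ∀ a ∈ G.g Sg (-1), ∀ b ∈ G.g Sg (-1), ⁅a, b⁆ ∈ D := fun a ha b hb => by
    rw [hD]; exact Submodule.subset_span ⟨a, ha, b, hb, rfl⟩
  -- negative simple roots outside `Sg` preserve `𝔤₋₁`
  have hstab : ∀ α ∈ G.base.Δ0, α ∉ Sg → ∀ x ∈ G.rs (-α), ∀ y ∈ G.g Sg (-1),
      ⁅x, y⁆ ∈ G.g Sg (-1) := by
    intro α hα hαS x hx y hy
    have hαΔ := G.base.base_sub hα
    have hnα := G.base.neg_mem α hαΔ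
    have hα0 : G.base.ht Sg (-α) = 0 := by
      rw [G.base.ht_neg hSg hαΔ, G.base.ht_simple hSg hα, if_neg hαS, neg_zero]
    have : G.g Sg (-1) ≤ (G.g Sg (-1)).comap (LieAlgebra.ad ℂ L x) := by
      refine G.g_le Sg (by norm_num) _ (fun γ hγ hγ1 z hz => ?_)
      simp only [Submodule.mem_comap]
      change ⁅x, z⁆ ∈ _
      by_cases hsum : -α + γ ∈ G.base.Δ
      · have := G.rs_le_g Sg hsum (G.br_rs_mem _ hnα γ hγ hsum x hx z hz)
        rwa [G.base.ht_add hSg hnα hγ hsum, hα0, hγ1, zero_add] at this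
      · rw [G.br_rs_zero _ hnα γ hγ hsum ?_ x hx z hz]
        · exact Submodule.zero_mem _
        · intro h0
          have : γ = α := by rw [← sub_eq_zero, ← h0]; abel
          rw [this, G.base.ht_simple hSg hα, if_neg hαS] at hγ1
          norm_num at hγ1
    exact this hy
  have hDstab : ∀ α ∈ G.base.Δ0, α ∉ Sg → ∀ x ∈ G.rs (-α), ∀ y ∈ D, ⁅x, y⁆ ∈ D := by
    intro α hα hαS x hx y hy
    rw [hD] at hy
    induction hy using Submodule.span_induction with
    | mem z hz =>
      obtain ⟨a, ha, b, hb, rfl⟩ := hz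
      rw [leibniz_lie]
      exact D.add_mem (hD1 _ (hstab α hα hαS x hx a ha) _ hb)
        (hD1 _ ha _ (hstab α hα hαS x hx b hb))
    | zero => simp
    | add a b _ _ iha ihb => rw [lie_add]; exact D.add_mem iha ihb
    | smul c a _ iha => rw [lie_smul]; exact D.smul_mem _ iha
  have main : ∀ n : ℕ, ∀ β ∈ G.base.Δ, G.base.ht Sg β = 2 → G.base.ht G.base.Δ0 β < n →
      G.rs (-β) ≤ D := by
    intro n
    induction n with
    | zero =>
      intro β hβ hp hn
      have := G.base.ht_base_nonneg hSg hβ (by omega)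
      simp at hn; omega
    | succ n ih =>
      intro β hβ hp hn
      obtain ⟨α, hα, h | h⟩ := G.base.exists_simple hβ
        (G.base.coeff_nonneg_of_ht_pos hSg hβ (by omega))
      · subst h
        rw [G.base.ht_simple hSg hα] at hp
        split_ifs at hp <;> omega
      · have hαΔ := G.base.base_sub hα
        have e : α + (β - α) = β := by abel
        have e' : -α + -(β - α) = -β := by abel
        have hβ' : α + (β - α) ∈ G.base.Δ := by rwa [e]
        have hnβ' : -α + -(β - α) ∈ G.base.Δ := by rw [e']; exact G.base.neg_mem β hβ
        have e1 := G.base.ht_add hSg hαΔ h hβ'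
        have e2 := G.base.ht_add (le_refl _) hαΔ h hβ'
        rw [e, G.base.ht_simple hSg hα] at e1
        rw [e, G.base.ht_simple (le_refl _) hα, if_pos hα] at e2
        have hnα := G.base.neg_mem α hαΔ
        have hnγ := G.base.neg_mem _ h
        have := G.rs_le_of_add hnα hnγ hnβ' D (by
          intro x hx y hy
          by_cases hαS : α ∈ Sg
          · rw [if_pos hαS] at e1
            have k1 := G.rs_le_g Sg hnα hx
            have k2 := G.rs_le_g Sg hnγ hy
            rw [G.base.ht_neg hSg hαΔ, G.base.ht_simple hSg hα, if_pos hαS] at k1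
            rw [G.base.ht_neg hSg h, show G.base.ht Sg (β - α) = 1 by omega] at k2
            exact hD1 _ k1 _ k2
          · rw [if_neg hαS] at e1
            exact hDstab α hα hαS x hx y
              (ih _ h (by omega) (by push_cast at hn; omega) hy))
        rwa [e'] at this
  refine G.g_le Sg (by norm_num) _ (fun β hβ h2 => ?_)
  have := main ((G.base.ht G.base.Δ0 (-β)).toNat + 1) (-β) (G.base.neg_mem β hβ)
    (by rw [G.base.ht_neg hSg hβ, h2]; norm_num) (by push_cast; omega)
  rwa [neg_neg] at this

theorem ker_ad [FiniteDimensional ℂ L] (G : GradedLieData V L) {Sg : Finset V}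
    (hSg : Sg ⊆ G.base.Δ0) (Y : Submodule ℂ L) (hY : Y ≤ G.g Sg (-1))
    (hab : ∀ a ∈ Y, ∀ b ∈ Y, ⁅a, b⁆ = (0 : L))
    (hc : Module.finrank ℂ Y + 1 = Module.finrank ℂ (G.g Sg (-1)))
    (h2 : Module.finrank ℂ (G.g Sg (-2)) = Module.finrank ℂ Y)
    {z w : L} (hz : z ∈ G.g Sg (-1)) (hzY : z ∉ Y) (hw : w ∈ G.g Sg (-1)) (hzw : ⁅z, w⁆ = 0) :
    ∃ c : ℂ, w = c • z := by
  have hsup : Y ⊔ Submodule.span ℂ {z} = G.g Sg (-1) := by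
    apply Submodule.eq_of_le_of_finrank_le
    · exact sup_le hY (by simpa using hz)
    · rw [← hc]
      exact Submodule.finrank_lt_finrank_of_lt
        (lt_of_le_of_ne le_sup_left (fun h => hzY (h ▸ Submodule.mem_sup_right
          (Submodule.mem_span_singleton_self z))))
  have hdec : ∀ a ∈ G.g Sg (-1), ∃ y ∈ Y, ∃ c : ℂ, a = y + c • z := by
    intro a ha
    rw [← hsup] at ha
    obtain ⟨y, hy, t, ht, rfl⟩ := Submodule.mem_sup.mp ha
    obtain ⟨c, rfl⟩ := Submodule.mem_span_singleton.mp ht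
    exact ⟨y, hy, c, rfl⟩
  let φ : Y →ₗ[ℂ] L := (LieAlgebra.ad ℂ L z).comp Y.subtype
  have hφ : ∀ y : Y, φ y = ⁅z, (y : L)⁆ := fun y => rfl
  have hle : G.g Sg (-2) ≤ LinearMap.range φ := by
    refine (G.g_two_le hSg _ rfl).trans (Submodule.span_le.mpr ?_)
    rintro _ ⟨a, ha, b, hb, rfl⟩
    obtain ⟨y, hy, c, rfl⟩ := hdec a ha
    obtain ⟨y', hy', c', rfl⟩ := hdec b hb
    refine ⟨c • ⟨y', hy'⟩ - c' • ⟨y, hy⟩, ?_⟩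
    rw [map_sub, map_smul, map_smul, hφ, hφ]
    simp only [add_lie, lie_add, smul_lie, lie_smul, hab y hy y' hy', lie_self, smul_zero]
    rw [← lie_skew z y]
    simp only [smul_neg]
    abel
  have hr := Submodule.finrank_mono hle
  have hrk := LinearMap.finrank_range_add_finrank_ker φ
  have hker : LinearMap.ker φ = ⊥ := Submodule.finrank_eq_zero.mp (by omega)
  obtain ⟨y, hy, c, rfl⟩ := hdec w hw
  have : φ ⟨y, hy⟩ = 0 := by
    rw [hφ]; simpa using hzw
  have h0 : (⟨y, hy⟩ : Y) = 0 := by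
    have : (⟨y, hy⟩ : Y) ∈ LinearMap.ker φ := this
    rw [hker] at this; simpa using this
  exact ⟨c, by rw [show y = 0 from congrArg Subtype.val h0, zero_add]⟩

/-- Under the Monge condition, no decomposition into two ideals both meeting `𝔤₋₁`. -/
theorem not_both [FiniteDimensional ℂ L] (G : GradedLieData V L) {Sg : Finset V}
    (hSg : Sg ⊆ G.base.Δ0) (hM : G.Monge Sg) (I J : LieIdeal ℂ L)
    (hd : ∀ x, x ∈ I → x ∈ J → x = 0) (hs : ∀ x : L, ∃ a ∈ I, ∃ b ∈ J, a + b = x)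
    {p q : L} (hp : p ∈ I) (hp1 : p ∈ G.g Sg (-1)) (hp0 : p ≠ 0)
    (hq : q ∈ J) (hq1 : q ∈ G.g Sg (-1)) (hq0 : q ≠ 0) : False := by
  obtain ⟨Y, hY, -, hab, hc, h2⟩ := hM
  have hIJ : ∀ x ∈ I, ∀ y ∈ J, ⁅x, y⁆ = 0 := fun x hx y hy =>
    hd _ (lie_mem_left ℂ L I x y hx) (J.lie_mem hy)
  have key : G.g Sg (-1) ≤ Y := by
    refine G.g_le Sg (by norm_num) _ (fun β hβ h1 x hx => ?_)
    by_contra hxY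
    have hx1 := G.rs_le_g Sg hβ hx
    rw [h1] at hx1
    rcases G.rs_le_or I J hd hs hβ with h | h
    · obtain ⟨c, e⟩ := G.ker_ad hSg Y hY hab hc h2 hx1 hxY hq1 (hIJ x (h x hx) q hq)
      exact hq0 (hd q (by rw [e]; exact I.smul_mem c (h x hx)) hq)
    · obtain ⟨c, e⟩ := G.ker_ad hSg Y hY hab hc h2 hx1 hxY hp1
        (by rw [← lie_skew, hIJ p hp x (h x hx), neg_zero])
      exact hp0 (hd p hp (by rw [e]; exact J.smul_mem c (h x hx)))
  have := Submodule.finrank_mono key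
  omega

/-- an ideal factor not inside `𝔤₀` meets `𝔤₋₁` -/
theorem exists_mem (G : GradedLieData V L) {Sg : Finset V} (hSg : Sg ⊆ G.base.Δ0)
    (I J : LieIdeal ℂ L)
    (hd : ∀ x, x ∈ I → x ∈ J → x = 0) (hs : ∀ x : L, ∃ a ∈ I, ∃ b ∈ J, a + b = x)
    (hI : ¬ (I : Submodule ℂ L) ≤ G.g Sg 0) : ∃ p ∈ I, p ∈ G.g Sg (-1) ∧ p ≠ 0 := by
  by_contra hcon
  push Not at hcon
  refine hI (G.le_g_zero hSg I J hd hs fun β hβ h1 => ?_)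
  rcases G.rs_le_or I J hd hs hβ with h | h
  · intro x hx
    have k := G.rs_le_g Sg hβ hx
    rw [h1] at k
    rw [hcon x (h x hx) k]
    exact J.zero_mem
  · exact h

end GradedLieData

/-- Let `𝔤` be a complex semisimple Lie algebra whose grading
determined by a nonempty subset `Σ` of the simple roots is of Monge type, with
`dim 𝔤₋₁ > 2`.  If `𝔤₀` contains no simple ideal of `𝔤`, then `𝔤` is simple. -/
theorem statement5 {V : Type*} [NormedAddCommGroup V] [InnerProductSpace ℝ V]
    {L : Type*} [LieRing L] [LieAlgebra ℂ L] [FiniteDimensional ℂ L]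
    (hss : LieAlgebra.IsSemisimple ℂ L)
    (G : GradedLieData V L) (Sg : Finset V) (hSg : Sg ⊆ G.base.Δ0) (hne : Sg.Nonempty)
    (hM : G.Monge Sg)
    (hdim : 2 < Module.finrank ℂ ↥(G.g Sg (-1)))
    (hid : ¬ ∃ I : LieIdeal ℂ L, LieAlgebra.IsSimple ℂ ↥I ∧
        (I : Submodule ℂ L) ≤ G.g Sg 0) :
    LieAlgebra.IsSimple ℂ L := by
  have := hss
  have hnot : ∀ I : LieIdeal ℂ L, I ≠ ⊥ → ¬ (I : Submodule ℂ L) ≤ G.g Sg 0 := by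
    intro I hI hle
    obtain ⟨A, hA, hAI⟩ := (eq_bot_or_exists_atom_le I).resolve_left hI
    exact hid ⟨A, LieAlgebra.IsSemisimple.isSimple_of_isAtom A hA, le_trans hAI hle⟩
  refine ⟨fun I => ?_, fun hab => ?_⟩
  · by_contra hcon
    push Not at hcon
    obtain ⟨hI, hI'⟩ := hcon
    have hc : IsCompl I Iᶜ := isCompl_compl
    generalize Iᶜ = J at hc
    have hd : ∀ x, x ∈ I → x ∈ J → x = 0 := fun x h1 h2 =>
      Submodule.disjoint_def.mp (LieSubmodule.disjoint_toSubmodule.mpr hc.disjoint) x h1 h2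
    have hs : ∀ x : L, ∃ a ∈ I, ∃ b ∈ J, a + b = x := fun x => by
      have h := LieSubmodule.codisjoint_toSubmodule.mpr hc.codisjoint
      have hx : x ∈ (I : Submodule ℂ L) ⊔ (J : Submodule ℂ L) := by
        exact (codisjoint_iff.mp h).ge trivial
      exact Submodule.mem_sup.mp hx
    have hJ : J ≠ ⊥ := by
      rintro rfl
      exact hI' (by simpa using hc.sup_eq_top)
    have hs' : ∀ x : L, ∃ a ∈ J, ∃ b ∈ I, a + b = x := fun x => by
      obtain ⟨a, ha, b, hb, e⟩ := hs x
      exact ⟨b, hb, a, ha, by rw [add_comm, e]⟩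
    obtain ⟨p, hp, hp1, hp0⟩ := G.exists_mem hSg I J hd hs (hnot I hI)
    obtain ⟨q, hq, hq1, hq0⟩ := G.exists_mem hSg J I (fun x h1 h2 => hd x h2 h1) hs' (hnot J hJ)
    exact G.not_both hSg hM I J hd hs hp hp1 hp0 hq hq1 hq0
  · have : Subsingleton L := LieAlgebra.subsingleton_of_hasTrivialRadical_lie_abelian ℂ L
    obtain ⟨Y, -, hY, -⟩ := hM
    exact hY (Subsingleton.elim _ _)
end

section
/- Let Δ be the root system of a complex simple Lie algebra with base of simple roots Δ⁰, and let Σ ⊆ Δ⁰ be a nonempty subset containing a root ζ which is adjacent in the Dynkin diagram to every other root of Σ. If γ is a root of Σ-height 0, α ∈ Σ∖{ζ}, β ∈ Υ¹_α, and γ + β is a root, then γ + β ∈ Υ¹_α. -/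
open scoped RealInnerProductSpace BigOperators Classical

namespace RootSystemBase

variable {V : Type*} [NormedAddCommGroup V] [InnerProductSpace ℝ V]

variable (R : RootSystemBase V)

/-- `R.comp ζ α` is the connected component containing `α` of the Dynkin diagram of
`Δ⁰ ∖ {ζ}`:  all simple roots `γ ≠ ζ` joined to `α` by a path of adjacent simple
roots avoiding `ζ`. -/
def comp (ζ α : V) : Set V :=
  {γ : V | γ ∈ R.Δ0 ∧ γ ≠ ζ ∧
    Relation.ReflTransGen
      (fun u w => u ∈ R.Δ0 ∧ w ∈ R.Δ0 ∧ u ≠ ζ ∧ w ≠ ζ ∧ Adj u w) α γ}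

/-- `Υ¹_α`: the roots of the form `β = α + ∑ nᵢ βᵢ` with `βᵢ ∈ Υ_α ∖ {α}` and
`nᵢ > 0` (`m ≥ 0` summands); equivalently the roots of `{α}`-height one in the
subsystem with simple roots `Υ_α`. -/
def Ups1 (ζ α : V) : Set V :=
  {β : V | β ∈ R.Δ ∧ ∃ n : V → ℕ,
      (∀ γ : V, n γ ≠ 0 → γ ∈ R.comp ζ α ∧ γ ≠ α) ∧
      β = α + ∑ γ ∈ R.Δ0, (n γ : ℝ) • γ}

end RootSystemBase

namespace RootSystemBase

theorem coeff_unique_s9 {V : Type*} [NormedAddCommGroup V] [InnerProductSpace ℝ V]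
    (R : RootSystemBase V) (c d : V → ℝ)
    (h : ∑ a ∈ R.Δ0, c a • a = ∑ a ∈ R.Δ0, d a • a) : ∀ a ∈ R.Δ0, c a = d a := by
  intro a ha
  have h1 := Fintype.linearIndependent_iff.1 R.indep (fun x => c x - d x) (by
    rw [Finset.sum_coe_sort R.Δ0 (fun x => (c x - d x) • x)]
    simp only [sub_smul, Finset.sum_sub_distrib, h, sub_self]) ⟨a, ha⟩
  exact sub_eq_zero.1 h1

theorem coeff_eq_s9 {V : Type*} [NormedAddCommGroup V] [InnerProductSpace ℝ V]
    (R : RootSystemBase V) (δ : V) (hδ : δ ∈ R.Δ) (d : V → ℝ)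
    (h : δ = ∑ a ∈ R.Δ0, d a • a) : ∀ a ∈ R.Δ0, (R.coeff δ a : ℝ) = d a :=
  R.coeff_unique_s9 _ _ ((R.coeff_spec δ hδ).symm.trans h)

/-- The support of a positive root cannot be split into two orthogonal nonempty parts. -/
theorem no_split {V : Type*} [NormedAddCommGroup V] [InnerProductSpace ℝ V]
    (R : RootSystemBase V) (S : Finset V) (hS : S ⊆ R.Δ0) (n : ℕ) :
    ∀ δ ∈ R.Δ, (∀ a ∈ R.Δ0, 0 ≤ R.coeff δ a) → (∑ a ∈ S, R.coeff δ a).toNat = n →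
      (∀ a ∈ S, ∀ b ∈ R.Δ0, b ∉ S → R.coeff δ b ≠ 0 → ⟪b, a⟫ = 0) →
      (∃ a ∈ S, R.coeff δ a ≠ 0) → (∃ b ∈ R.Δ0, b ∉ S ∧ R.coeff δ b ≠ 0) → False := by
  induction n using Nat.strong_induction_on with
  | _ n ih =>
  intro δ hδ hpos hn horth hexS hexT
  have key : ∀ ε ∈ R.Δ, (∀ b ∈ R.Δ0, b ∉ S → R.coeff ε b = R.coeff δ b) → ∀ a ∈ S,
      ⟪ε, a⟫ = ∑ b ∈ S, (R.coeff ε b : ℝ) * ⟪b, a⟫ := by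
    intro ε hε hεδ a ha
    conv_lhs => rw [R.coeff_spec ε hε]
    rw [sum_inner]
    simp only [real_inner_smul_left]
    symm
    apply Finset.sum_subset hS
    intro b hb hbS
    by_cases h0 : R.coeff δ b = 0
    · simp [hεδ b hb hbS, h0]
    · simp [horth a ha b hb hbS h0]
  obtain ⟨a, ha, hapos⟩ : ∃ a ∈ S, 0 < ⟪δ, a⟫ := by
    by_contra hcon
    push Not at hcon
    set s : V := ∑ b ∈ S, (R.coeff δ b : ℝ) • b with hs
    have hsa : ∀ a ∈ S, ⟪s, a⟫ = ⟪δ, a⟫ := by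
      intro a ha
      rw [key δ hδ (fun _ _ _ => rfl) a ha, hs, sum_inner]
      simp only [real_inner_smul_left]
    have hss : ⟪s, s⟫ ≤ 0 := by
      conv_lhs => rw [hs]
      rw [← hs, sum_inner]
      apply Finset.sum_nonpos
      intro b hb
      rw [real_inner_smul_left, real_inner_comm, hsa b hb]
      exact mul_nonpos_of_nonneg_of_nonpos (by exact_mod_cast hpos b (hS hb)) (hcon b hb)
    have hs0 : s = 0 := inner_self_eq_zero.1 (le_antisymm hss real_inner_self_nonneg)
    obtain ⟨a, ha, hane⟩ := hexS
    have := R.coeff_unique_s9 (fun b => if b ∈ S then (R.coeff δ b : ℝ) else 0) (fun _ => 0) (by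
      simp only [ite_smul, zero_smul, Finset.sum_const_zero]
      rw [← Finset.sum_filter, Finset.filter_mem_eq_inter, Finset.inter_eq_right.2 hS]
      exact hs0) a (hS ha)
    simp only [ha, if_true] at this
    exact hane (by exact_mod_cast this)
  have haΔ := R.base_sub (hS ha)
  have haa : 0 < ⟪a, a⟫ := real_inner_self_pos.2 (R.ne_zero a haΔ)
  obtain ⟨k, hk⟩ := R.crystal a haΔ δ hδ
  have hkpos : 0 < k := by
    have : (0:ℝ) < k := by rw [← hk]; positivity
    exact_mod_cast this
  have hε := R.reflect_mem a haΔ δ hδ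
  have hεa : ⟪δ - (2 * ⟪δ, a⟫ / ⟪a, a⟫) • a, a⟫ = - ⟪δ, a⟫ := by
    rw [inner_sub_left, real_inner_smul_left]
    field_simp
    ring
  rw [hk] at hε hεa
  set ε := δ - (k : ℝ) • a with hεdef
  have hc : ∀ b ∈ R.Δ0, R.coeff ε b = R.coeff δ b - if b = a then k else 0 := by
    intro b hb
    have := R.coeff_eq_s9 ε hε (fun b => (R.coeff δ b : ℝ) - if b = a then (k:ℝ) else 0) (by
      simp only [sub_smul, Finset.sum_sub_distrib, ite_smul, zero_smul]
      rw [← R.coeff_spec δ hδ, Finset.sum_ite_eq' R.Δ0 a, if_pos (hS ha)]) b hb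
    split_ifs at this ⊢ <;> exact_mod_cast this
  have hcT : ∀ b ∈ R.Δ0, b ∉ S → R.coeff ε b = R.coeff δ b := by
    intro b hb hbS
    rw [hc b hb, if_neg (fun h : b = a => hbS (h ▸ ha)), sub_zero]
  have hεpos : ∀ b ∈ R.Δ0, 0 ≤ R.coeff ε b := by
    rcases R.coeff_sign ε hε with h | h
    · exact h
    · obtain ⟨b, hb, hbS, hb0⟩ := hexT
      have h1 := h b hb
      rw [hcT b hb hbS] at h1
      exact absurd (le_antisymm h1 (hpos b hb)) hb0
  have hsumε : ∑ b ∈ S, R.coeff ε b = ∑ b ∈ S, R.coeff δ b - k := by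
    rw [Finset.sum_congr rfl (fun b hb => hc b (hS hb)), Finset.sum_sub_distrib,
      Finset.sum_ite_eq' S a, if_pos ha]
  have hsum0 : 0 ≤ ∑ b ∈ S, R.coeff ε b := Finset.sum_nonneg fun b hb => hεpos b (hS hb)
  refine ih _ ?_ ε hε hεpos rfl ?_ ?_ ?_
  · omega
  · intro a' ha' b hb hbS hb0
    rw [hcT b hb hbS] at hb0
    exact horth a' ha' b hb hbS hb0
  · by_contra hcon
    push Not at hcon
    have h1 := key ε hε hcT a ha
    rw [Finset.sum_eq_zero (fun b hb => by simp [hcon b hb])] at h1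
    linarith
  · obtain ⟨b, hb, hbS, hb0⟩ := hexT
    exact ⟨b, hb, hbS, by rwa [hcT b hb hbS]⟩

end RootSystemBase

/-- Let `Δ` be the root system of a complex simple Lie algebra with
base `Δ⁰`, and let `Σ ⊆ Δ⁰` be nonempty with a root `ζ` adjacent to every other root
of `Σ`.  If `γ` is a root of `Σ`-height `0`, `α ∈ Σ∖{ζ}`, `β ∈ Υ¹_α`, and `γ + β` is
a root, then `γ + β ∈ Υ¹_α`. -/
theorem statement9 {V : Type*} [NormedAddCommGroup V] [InnerProductSpace ℝ V]
    (R : RootSystemBase V) (hirr : R.Irred)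
    (Sg : Finset V) (hSg : Sg ⊆ R.Δ0)
    (ζ : V) (hζ : ζ ∈ Sg) (hadj : ∀ a ∈ Sg, a ≠ ζ → RootSystemBase.Adj ζ a)
    (γ : V) (hγ : γ ∈ R.Δ) (hγ0 : R.ht Sg γ = 0)
    (α : V) (hα : α ∈ Sg) (hαζ : α ≠ ζ)
    (β : V) (hβ : β ∈ R.Ups1 ζ α)
    (hsum : γ + β ∈ R.Δ) :
    γ + β ∈ R.Ups1 ζ α := by
  obtain ⟨hβΔ, n, hn, hβeq⟩ := hβ
  have hα0 : α ∈ R.Δ0 := hSg hα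
  have hcγ : ∀ a ∈ Sg, R.coeff γ a = 0 := by
    unfold RootSystemBase.ht at hγ0
    rcases R.coeff_sign γ hγ with h | h
    · exact (Finset.sum_eq_zero_iff_of_nonneg fun a ha => h a (hSg ha)).1 hγ0
    · exact (Finset.sum_eq_zero_iff_of_nonpos fun a ha => h a (hSg ha)).1 hγ0
  have hc : ∀ b ∈ R.Δ0,
      R.coeff (γ + β) b = R.coeff γ b + ((if b = α then 1 else 0) + (n b : ℤ)) := by
    intro b hb
    have := R.coeff_eq_s9 (γ + β) hsum
      (fun b => (R.coeff γ b : ℝ) + ((if b = α then (1:ℝ) else 0) + (n b : ℝ))) (by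
        simp only [add_smul, Finset.sum_add_distrib, ite_smul, zero_smul, one_smul]
        rw [← R.coeff_spec γ hγ, Finset.sum_ite_eq' R.Δ0 α, if_pos hα0, ← hβeq]) b hb
    split_ifs at this ⊢ <;> exact_mod_cast this
  have hnα : n α = 0 := by
    by_contra h
    exact (hn α h).2 rfl
  have hnζ : n ζ = 0 := by
    by_contra h
    exact (hn ζ h).1.2.1 rfl
  have hcα : R.coeff (γ + β) α = 1 := by
    rw [hc α hα0, hcγ α hα, hnα]; simp
  have hcζ : R.coeff (γ + β) ζ = 0 := by
    rw [hc ζ (hSg hζ), hcγ ζ hζ, hnζ, if_neg (Ne.symm hαζ)]; simp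
  have hpos : ∀ b ∈ R.Δ0, 0 ≤ R.coeff (γ + β) b := by
    rcases R.coeff_sign (γ + β) hsum with h | h
    · exact h
    · have := h α hα0
      omega
  have hsupp : ∀ b ∈ R.Δ0, R.coeff (γ + β) b ≠ 0 → b ∈ R.comp ζ α := by
    intro b hb hb0
    by_contra hbc
    refine R.no_split (R.Δ0.filter (fun x => x ∈ R.comp ζ α)) (Finset.filter_subset _ _) _
      (γ + β) hsum hpos rfl ?_ ⟨α, ?_, by omega⟩ ⟨b, hb, by simp [hbc], hb0⟩
    · intro x hx y hy hyS hy0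
      have hxc := (Finset.mem_filter.1 hx).2
      have hyc : y ∉ R.comp ζ α := fun h => hyS (Finset.mem_filter.2 ⟨hy, h⟩)
      have hyζ : y ≠ ζ := by
        rintro rfl
        exact hy0 hcζ
      by_contra hinn
      refine hyc ⟨hy, hyζ, hxc.2.2.tail ⟨hxc.1, hy, hxc.2.1, hyζ, ?_, ?_⟩⟩
      · rintro rfl
        exact hyc hxc
      · rwa [real_inner_comm]
    · exact Finset.mem_filter.2 ⟨hα0, hα0, hαζ, Relation.ReflTransGen.refl⟩
  refine ⟨hsum, fun b => if b ∈ R.Δ0 ∧ b ≠ α then (R.coeff (γ + β) b).toNat else 0, ?_, ?_⟩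
  · intro b hb
    by_cases h : b ∈ R.Δ0 ∧ b ≠ α
    · simp only [h, ne_eq, not_false_eq_true, and_self, if_true] at hb
      exact ⟨hsupp b h.1 (fun h0 => hb (by simp [h0])), h.2⟩
    · simp [h] at hb
  · have h1 : ∀ b ∈ R.Δ0, (R.coeff (γ + β) b : ℝ) • b = (if b = α then b else 0) +
        (((if b ∈ R.Δ0 ∧ b ≠ α then (R.coeff (γ + β) b).toNat else 0 : ℕ) : ℝ)) • b := by
      intro b hb
      by_cases h : b = α
      · subst h
        simp [hcα]
      · have h2 : ((R.coeff (γ + β) b).toNat : ℤ) = R.coeff (γ + β) b :=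
          Int.toNat_of_nonneg (hpos b hb)
        have h3 : ((R.coeff (γ + β) b).toNat : ℝ) = (R.coeff (γ + β) b : ℝ) := by
          exact_mod_cast congrArg (Int.cast : ℤ → ℝ) h2
        rw [if_neg h, if_pos ⟨hb, h⟩, h3, zero_add]
    conv_lhs => rw [R.coeff_spec (γ + β) hsum]
    rw [Finset.sum_congr rfl h1, Finset.sum_add_distrib, Finset.sum_ite_eq' R.Δ0 α, if_pos hα0]
end
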